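/- Let G and G' be two (≤6)-hemimorphic arc-connected digraphs on the same vertex set. If G satisfies none of the conditions C_∞, L1, L2, then G and G' are hemimorphic. -/

import Mathlib

universe u v

/-- A digraph: an irreflexive binary relation on a vertex type. -/
structure Dgraph (V : Type u) where
  Arc : V → V → Prop
  irrefl : ∀ x, ¬ Arc x x

namespace Dgraph

variable {V : Type u} {W : Type v}

/-- The dual digraph. -/
def dual (G : Dgraph V) : Dgraph V :=
  ⟨fun x y => G.Arc y x, fun x h => G.irrefl x h⟩

/-- Subdigraph induced by a set of vertices. -/
def ind (G : Dgraph V) (X : Set V) : Dgraph X :=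
  ⟨fun x y => G.Arc x y, fun x h => G.irrefl x h⟩

/-- Isomorphism of digraphs. -/
def Iso (G : Dgraph V) (G' : Dgraph W) : Prop :=
  ∃ e : V ≃ W, ∀ x y, G.Arc x y ↔ G'.Arc (e x) (e y)

/-- `G` and `G'` are hemimorphic: `G'` is isomorphic to `G` or to its dual. -/
def Hemi (G : Dgraph V) (G' : Dgraph W) : Prop :=
  Iso G G' ∨ Iso G.dual G'

/-- Self-dual digraph. -/
def SelfDual (G : Dgraph V) : Prop := Iso G G.dual

/-- `{x,y}` is a directed pair. -/
def Dir (G : Dgraph V) (x y : V) : Prop :=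
  (G.Arc x y ∧ ¬ G.Arc y x) ∨ (G.Arc y x ∧ ¬ G.Arc x y)

/-- `{x,y}` is a neutral pair (full or void). -/
def Neutral (G : Dgraph V) (x y : V) : Prop :=
  x ≠ y ∧ ¬ G.Dir x y

/-- Interval of a digraph. -/
def IsInterval (G : Dgraph V) (I : Set V) : Prop :=
  ∀ x ∉ I,
    (∀ y ∈ I, G.Arc x y ∧ ¬ G.Arc y x) ∨ (∀ y ∈ I, G.Arc y x ∧ ¬ G.Arc x y) ∨
    (∀ y ∈ I, G.Arc x y ∧ G.Arc y x) ∨ (∀ y ∈ I, ¬ G.Arc x y ∧ ¬ G.Arc y x)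

/-- The arc-connectivity equivalence relation. -/
def ACRel (G : Dgraph V) : V → V → Prop := Relation.ReflTransGen G.Dir

/-- Arc-connected components. -/
def IsACComponent (G : Dgraph V) (D : Set V) : Prop :=
  ∃ x, D = {y | G.ACRel x y}

/-- Arc-connected digraph (at most one arc-connected component). -/
def ArcConnected (G : Dgraph V) : Prop := ∀ x y, G.ACRel x y

/-- Tournament. -/
def IsTournament (G : Dgraph V) : Prop := ∀ x y, x ≠ y → G.Dir x y

/-- Chain (transitive tournament). -/
def IsChainD (G : Dgraph V) : Prop :=
  G.IsTournament ∧ ∀ x y z, G.Arc x y → G.Arc y z → G.Arc x z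

/-- Dgraph from a relation, with forced irreflexivity. -/
def ofRel (r : V → V → Prop) : Dgraph V := ⟨fun x y => x ≠ y ∧ r x y, fun x h => h.1 rfl⟩

/-- The model flag. -/
def flagD : Dgraph (Fin 3) :=
  ofRel (fun x y => (x = 0 ∧ y = 1) ∨ (x = 1 ∧ y = 2) ∨ (x = 2 ∧ y = 1))

/-- First model peak. -/
def peakD1 : Dgraph (Fin 3) :=
  ofRel (fun x y => (x = 0 ∧ y = 1) ∨ (x = 0 ∧ y = 2) ∨ (x = 1 ∧ y = 2) ∨ (x = 2 ∧ y = 1))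

/-- Second model peak. -/
def peakD2 : Dgraph (Fin 3) :=
  ofRel (fun x y => (x = 0 ∧ y = 1) ∨ (x = 0 ∧ y = 2))

/-- The model diamond. -/
def diamondD : Dgraph (Fin 4) :=
  ofRel (fun x y => (x = 0 ∧ y = 1) ∨ (x = 0 ∧ y = 2) ∨ (x = 0 ∧ y = 3) ∨
    (x = 1 ∧ y = 2) ∨ (x = 2 ∧ y = 3) ∨ (x = 3 ∧ y = 1))

/-- A flag is a digraph hemimorphic to the model flag. -/
def IsFlag (G : Dgraph V) : Prop := Hemi G flagD

/-- A peak is a digraph hemimorphic to one of the two model peaks. -/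
def IsPeak (G : Dgraph V) : Prop := Hemi G peakD1 ∨ Hemi G peakD2

/-- A diamond is a digraph hemimorphic to the model diamond. -/
def IsDiamond (G : Dgraph V) : Prop := Hemi G diamondD

/-- Prechain: embeds no peak, no diamond, no two adjacent neutral pairs. -/
def IsPrechain (G : Dgraph V) : Prop :=
  (∀ X : Set V, ¬ IsPeak (G.ind X)) ∧ (∀ X : Set V, ¬ IsDiamond (G.ind X)) ∧
  ¬ ∃ x y z : V, y ≠ z ∧ G.Neutral x y ∧ G.Neutral x z

/-- Proper prechain: a prechain which is not a chain. -/
def ProperPrechain (G : Dgraph V) : Prop := G.IsPrechain ∧ ¬ G.IsChainD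

/-- Diamond-free tournament. -/
def DiamondFreeTournament (G : Dgraph V) : Prop :=
  G.IsTournament ∧ ∀ X : Set V, ¬ IsDiamond (G.ind X)

/-- Non-tournament prechain. -/
def NonTournamentPrechain (G : Dgraph V) : Prop := G.IsPrechain ∧ ¬ G.IsTournament

/-- Model finite consecutivity on `n` vertices (`full` decides whether the
non-consecutive pairs are all full or all void). -/
def consecFin (n : ℕ) (full : Bool) : Dgraph (Fin n) :=
  ofRel (fun i j => i.1 + 1 = j.1 ∨ (full = true ∧ (i.1 + 1 < j.1 ∨ j.1 + 1 < i.1)))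

/-- Model consecutivity of type ω. -/
def consecNat (full : Bool) : Dgraph ℕ :=
  ofRel (fun i j => i + 1 = j ∨ (full = true ∧ (i + 1 < j ∨ j + 1 < i)))

/-- Model consecutivity of type ω*+ω. -/
def consecInt (full : Bool) : Dgraph ℤ :=
  ofRel (fun i j => i + 1 = j ∨ (full = true ∧ (i + 1 < j ∨ j + 1 < i)))

/-- One-end infinite consecutivity (obtained from ω or ω*). -/
def OneEndInfiniteConsecutivity (G : Dgraph V) : Prop :=
  ∃ full, Iso G (consecNat full) ∨ Iso G (consecNat full).dual

/-- Consecutivity. -/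
def IsConsecutivity (G : Dgraph V) : Prop :=
  (∃ n, 3 ≤ n ∧ ∃ full, Iso G (consecFin n full)) ∨
  G.OneEndInfiniteConsecutivity ∨ (∃ full, Iso G (consecInt full))

/-- Model cycle on `n ≥ 3` vertices obtained from the finite consecutivity by
replacing the neutral pair `{0, n-1}` by the arc `(n-1, 0)`. -/
def cycleD (n : ℕ) (full : Bool) : Dgraph (Fin n) :=
  ofRel (fun i j => i.1 + 1 = j.1 ∨ (i.1 = n - 1 ∧ j.1 = 0) ∨
    (full = true ∧ (i.1 + 1 < j.1 ∨ j.1 + 1 < i.1) ∧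
      ¬ (i.1 = 0 ∧ j.1 = n - 1) ∧ ¬ (i.1 = n - 1 ∧ j.1 = 0)))

/-- Cycle. -/
def IsCycle (G : Dgraph V) : Prop := ∃ n, 3 ≤ n ∧ ∃ full, Iso G (cycleD n full)

/-- Near-chain: obtained from a chain by exchanging the directed pair formed
by its extremities. -/
def IsNearChain (G : Dgraph V) : Prop :=
  ∃ (H : Dgraph V) (m M : V), H.IsChainD ∧ m ≠ M ∧
    (∀ x, x ≠ m → H.Arc m x) ∧ (∀ x, x ≠ M → H.Arc x M) ∧
    (∀ x y, G.Arc x y ↔ ((H.Arc x y ∧ ¬ (x = m ∧ y = M)) ∨ (x = M ∧ y = m)))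

/-- `{k}`-hypomorphy. -/
def KHypo (k : ℕ) (G G' : Dgraph V) : Prop :=
  ∀ X : Set V, X.Finite → X.ncard = k → Iso (G.ind X) (G'.ind X)

/-- `(≤ k)`-hypomorphy. -/
def LeHypo (k : ℕ) (G G' : Dgraph V) : Prop :=
  ∀ j, 1 ≤ j → j ≤ k → KHypo j G G'

/-- `{k}`-hemimorphy. -/
def KHemi (k : ℕ) (G G' : Dgraph V) : Prop :=
  ∀ X : Set V, X.Finite → X.ncard = k → Hemi (G.ind X) (G'.ind X)

/-- `(≤ k)`-hemimorphy. -/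
def LeHemi (k : ℕ) (G G' : Dgraph V) : Prop :=
  ∀ j, 1 ≤ j → j ≤ k → KHemi j G G'

/-- `(≤ k)`-half-reconstructibility. -/
def HalfRecon (k : ℕ) (G : Dgraph V) : Prop :=
  ∀ G' : Dgraph V, LeHemi k G G' → Hemi G G'

/-- One step of the difference relation. -/
def DiffStep (G G' : Dgraph V) (x y : V) : Prop := G.Arc x y ↔ ¬ G'.Arc x y

/-- The difference relation `𝔇_{G,G'}`. -/
def DiffRel (G G' : Dgraph V) (x y : V) : Prop :=
  x = y ∨ Relation.TransGen (DiffStep G G') x y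

/-- Difference classes: `C ∈ D_{G,G'}`. -/
def DiffClass (G G' : Dgraph V) (C : Set V) : Prop :=
  ∃ x, C = {y | DiffRel G G' x y}

/-- The difference relation has at least two equivalence classes. -/
def AtLeastTwoDiffClasses (G G' : Dgraph V) : Prop :=
  ∃ C₁ C₂ : Set V, DiffClass G G' C₁ ∧ DiffClass G G' C₂ ∧ C₁ ≠ C₂

/-- `C_dual(G)`: the smallest cardinality of a finite set of vertices inducing a
non-self-dual subdigraph (`⊤` if there is none). -/
noncomputable def Cdual (G : Dgraph V) : ℕ∞ :=
  sInf {n : ℕ∞ | ∃ X : Set V, X.Finite ∧ ¬ SelfDual (G.ind X) ∧ n = (X.ncard : ℕ∞)}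

/-- The contracted digraph `G_I` (the vertex `none` plays the role of `I`). -/
def contract (G : Dgraph V) (I : Set V) : Dgraph (Option {x : V // x ∉ I}) where
  Arc := fun a b =>
    match a, b with
    | some x, some y => G.Arc x.1 y.1
    | some x, none => ∃ z ∈ I, G.Arc x.1 z
    | none, some y => ∃ z ∈ I, G.Arc z y.1
    | none, none => False
  irrefl := by
    rintro (_ | ⟨x, hx⟩)
    · simp
    · exact G.irrefl x

/-- There is an isomorphism `f` from `G_I` onto `G'_I` with `f(I) = I`. -/
def ContractIsoFix (G G' : Dgraph V) (I : Set V) : Prop :=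
  ∃ e : Option {x : V // x ∉ I} ≃ Option {x : V // x ∉ I},
    e none = none ∧ ∀ a b, (G.contract I).Arc a b ↔ (G'.contract I).Arc (e a) (e b)

/-- `D` is disjoint from every flag of `G`. -/
def FlagDisjoint (G : Dgraph V) (D : Set V) : Prop :=
  ∀ F : Set V, IsFlag (G.ind F) → D ∩ F = ∅

/-- `D` contains a vertex `a` of a flag `{a,b,c}` of `G` with `b, c ∉ D` and
`{b,c}` the directed pair of the flag. -/
def FlagVertexCond (G : Dgraph V) (D : Set V) : Prop :=
  ∃ a ∈ D, ∃ b c : V, b ∉ D ∧ c ∉ D ∧ IsFlag (G.ind {a, b, c}) ∧ G.Dir b c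

/-- Condition `C_∞`. -/
def CondCinf (G : Dgraph V) : Prop :=
  (∃ I : Set V, I.Infinite ∧ G.IsInterval I ∧ (G.ind I).IsChainD) ∨
  (∃ I J : Set V, I ≠ J ∧ G.IsInterval I ∧ G.IsInterval J ∧
     (G.ind I).OneEndInfiniteConsecutivity ∧ (G.ind J).OneEndInfiniteConsecutivity) ∨
  (∃ I : Set V, G.IsInterval I ∧ (G.ind I).OneEndInfiniteConsecutivity ∧
     (∀ J : Set V, G.IsInterval J → (G.ind J).OneEndInfiniteConsecutivity → J = I) ∧
     ¬ ContractIsoFix G G.dual I)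

/-- The kind of component occurring in conditions `K1` and `K2`. -/
def K12Kind (G : Dgraph V) (D : Set V) : Prop :=
  DiamondFreeTournament (G.ind D) ∨ (NonTournamentPrechain (G.ind D) ∧ G.FlagDisjoint D)

/-- Condition `K1`. -/
def CondK1 (G : Dgraph V) : Prop :=
  G.Cdual = 3 ∧ ∃ D₁ D₂ : Set V, D₁ ≠ D₂ ∧
    (G.IsACComponent D₁ ∧ ¬ SelfDual (G.ind D₁) ∧ G.IsInterval D₁ ∧ G.K12Kind D₁) ∧
    (G.IsACComponent D₂ ∧ ¬ SelfDual (G.ind D₂) ∧ G.IsInterval D₂ ∧ G.K12Kind D₂)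

/-- Condition `K2`. -/
def CondK2 (G : Dgraph V) : Prop :=
  G.Cdual = 3 ∧ ∃ D₀ : Set V, G.IsACComponent D₀ ∧ ¬ SelfDual (G.ind D₀) ∧
    (∀ D, G.IsACComponent D → ¬ SelfDual (G.ind D) → D = D₀) ∧
    G.K12Kind D₀ ∧ ¬ ContractIsoFix G G.dual D₀

/-- Condition `K3`. -/
def CondK3 (G : Dgraph V) : Prop :=
  G.Cdual = 4 ∧ ∃ D₁ D₂ : Set V, D₁ ≠ D₂ ∧
    (G.IsACComponent D₁ ∧ ¬ SelfDual (G.ind D₁) ∧ G.IsInterval D₁) ∧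
    (G.IsACComponent D₂ ∧ ¬ SelfDual (G.ind D₂) ∧ G.IsInterval D₂)

/-- Condition `K4`. -/
def CondK4 (G : Dgraph V) : Prop :=
  G.Cdual = 5 ∧ ∃ D₁ D₂ : Set V, D₁ ≠ D₂ ∧
    (G.IsACComponent D₁ ∧ ¬ SelfDual (G.ind D₁) ∧ G.IsInterval D₁ ∧ IsPrechain (G.ind D₁)) ∧
    (G.IsACComponent D₂ ∧ ¬ SelfDual (G.ind D₂) ∧ G.IsInterval D₂ ∧ IsPrechain (G.ind D₂))

/-- Condition `K5`. -/
def CondK5 (G : Dgraph V) : Prop :=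
  G.Cdual = 6 ∧ ∃ D₁ D₂ : Set V, D₁ ≠ D₂ ∧
    (G.IsACComponent D₁ ∧ ¬ SelfDual (G.ind D₁) ∧ G.IsInterval D₁ ∧
      DiamondFreeTournament (G.ind D₁)) ∧
    (G.IsACComponent D₂ ∧ ¬ SelfDual (G.ind D₂) ∧ G.IsInterval D₂ ∧
      DiamondFreeTournament (G.ind D₂))

/-- The kind of interval occurring in conditions `L1` and `L2`. -/
def L12Int (G : Dgraph V) (I : Set V) : Prop :=
  G.IsInterval I ∧ DiamondFreeTournament (G.ind I) ∧ ¬ SelfDual (G.ind I) ∧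
    ¬ G.IsACComponent I

/-- Condition `L1`. -/
def CondL1 (G : Dgraph V) : Prop :=
  ∃ I₁ I₂ : Set V, I₁ ≠ I₂ ∧ G.L12Int I₁ ∧ G.L12Int I₂

/-- Condition `L2`. -/
def CondL2 (G : Dgraph V) : Prop :=
  ∃ I₀ : Set V, G.L12Int I₀ ∧ (∀ I, G.L12Int I → I = I₀) ∧ ¬ ContractIsoFix G G.dual I₀

/-- Condition `L3`. -/
def CondL3 (G : Dgraph V) : Prop :=
  G.Cdual = 3 ∧ ∃ D₁ D₂ : Set V, D₁ ≠ D₂ ∧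
    (G.IsACComponent D₁ ∧ ¬ SelfDual (G.ind D₁) ∧ G.IsInterval D₁) ∧
    (G.IsACComponent D₂ ∧ ¬ SelfDual (G.ind D₂) ∧ G.IsInterval D₂) ∧
    ((G.FlagDisjoint D₁ ∧ Cdual (G.ind D₁) = 4 ∧ G.FlagDisjoint D₂ ∧ Cdual (G.ind D₂) = 4) ∨
     (NonTournamentPrechain (G.ind D₁) ∧ G.FlagVertexCond D₁ ∧
      NonTournamentPrechain (G.ind D₂) ∧ G.FlagVertexCond D₂))

/-- Condition `L4`. -/
def CondL4 (G : Dgraph V) : Prop :=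
  G.Cdual = 3 ∧ ∃ D₀ : Set V, G.IsACComponent D₀ ∧ ¬ SelfDual (G.ind D₀) ∧
    (∀ D, G.IsACComponent D → ¬ SelfDual (G.ind D) → D = D₀) ∧
    G.IsInterval D₀ ∧
    ((G.FlagDisjoint D₀ ∧ Cdual (G.ind D₀) = 4) ∨
     (NonTournamentPrechain (G.ind D₀) ∧ G.FlagVertexCond D₀)) ∧
    ¬ ContractIsoFix G G.dual D₀

end Dgraph

open Dgraph

namespace Dgraph

variable {V : Type u} {W : Type v}

/-- The digraph on `W` obtained by pulling back `G` along a map. -/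
def comap (f : W → V) (G : Dgraph V) : Dgraph W :=
  ⟨fun x y => G.Arc (f x) (f y), fun x h => G.irrefl (f x) h⟩

/-- Exchange of the two orientations in the encoding of pairs of vertices. -/
def swapCode : ℕ → ℕ
  | 1 => 2
  | 2 => 1
  | n => n

open Classical in
/-- The type of the pair `(x, y)`: `1` and `2` for directed pairs, `0` for void, `3` for full. -/
noncomputable def pairCode (G : Dgraph V) (x y : V) : ℕ :=
  (if G.Arc x y then 1 else 0) + (if G.Arc y x then 2 else 0)

/-- The upper triangular table of pair types of a list of vertices. -/
noncomputable def table (G : Dgraph V) : List V → List (List ℕ)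
  | [] => []
  | x :: l => l.map (pairCode G x) :: table G l

/-- Reading an entry in an upper triangular table. -/
def entry (L : List (List ℕ)) (i j : ℕ) : ℕ :=
  if i < j then (L.getD i []).getD (j - i - 1) 0
  else if j < i then swapCode ((L.getD j []).getD (i - j - 1) 0) else 0

/-- Backtracking search for an isomorphism extending a partial one. -/
def extendable (a b : ℕ → ℕ → ℕ) (n : ℕ) : ℕ → List ℕ → Bool
  | 0, _ => true
  | k + 1, p => (List.range n).any fun v =>
      !(p.elem v) && (List.range p.length).all (fun i => a i p.length == b (p.getD i 0) v) &&
        extendable a b n k (p ++ [v])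

/-- Decision procedure for hemimorphy of tables. -/
def hemiTable (n : ℕ) (A B : List (List ℕ)) : Bool :=
  extendable (entry A) (entry B) n n [] ||
    extendable (fun i j => entry A j i) (entry B) n n []

/-- Hemimorphy of all pairs of subdigraphs on at most six vertices, for injective families. -/
def HemiSix (G G' : Dgraph V) : Prop :=
  ∀ n ≤ 6, ∀ f : Fin n → V, Function.Injective f → Hemi (comap f G) (comap f G')

theorem pairCode_swap (G : Dgraph V) (x y : V) : pairCode G y x = swapCode (pairCode G x y) := by
  unfold pairCode
  split_ifs <;> rfl

theorem pairCode_lt (G : Dgraph V) (x y : V) : pairCode G x y < 4 := by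
  unfold pairCode
  split_ifs <;> decide

theorem pairCode_congr {G : Dgraph V} {G' : Dgraph W} {x y : V} {x' y' : W}
    (h : G.Arc x y ↔ G'.Arc x' y') (h' : G.Arc y x ↔ G'.Arc y' x') :
    pairCode G x y = pairCode G' x' y' := by
  classical
  unfold pairCode
  congr 1 <;> exact if_congr (by assumption) rfl rfl

theorem table_getD (G : Dgraph V) (l : List V) (i : ℕ) (hi : i < l.length) :
    (table G l).getD i [] = (l.drop (i + 1)).map (pairCode G l[i]) := by
  induction l generalizing i with
  | nil => simp at hi
  | cons x l ih =>
    cases i with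
    | zero => simp [table]
    | succ i => simpa [table] using ih i (by simpa using hi)

theorem entry_table_lt (G : Dgraph V) (l : List V) (i j : ℕ) (hj : j < l.length) (h : i < j) :
    ((table G l).getD i []).getD (j - i - 1) 0 = pairCode G (l[i]'(h.trans hj)) l[j] := by
  have hij : i + 1 + (j - i - 1) = j := by omega
  rw [table_getD G l i (h.trans hj), List.getD_eq_getElem _ _ (by simp; omega)]
  simp [hij]

theorem entry_table (G : Dgraph V) (l : List V) (i j : ℕ) (hi : i < l.length) (hj : j < l.length)
    (h : i ≠ j) : entry (table G l) i j = pairCode G l[i] l[j] := by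
  unfold entry
  rcases lt_or_gt_of_ne h with h | h
  · rw [if_pos h, entry_table_lt G l i j hj h]
  · rw [if_neg (by omega), if_pos h, entry_table_lt G l j i hi h, ← pairCode_swap]

theorem extendable_of_perm {a b : ℕ → ℕ → ℕ} {n : ℕ} {s : ℕ → ℕ} (hs : ∀ i < n, s i < n)
    (hinj : ∀ i < n, ∀ j < n, s i = s j → i = j)
    (h : ∀ i < n, ∀ j < n, i ≠ j → a i j = b (s i) (s j)) (k m : ℕ) (hk : m + k = n) :
    extendable a b n k ((List.range m).map s) = true := by
  induction k generalizing m with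
  | zero => rfl
  | succ k ih =>
    simp only [extendable, List.any_eq_true, List.mem_range]
    refine ⟨s m, hs m (by omega), ?_⟩
    have := ih (m + 1) (by omega)
    rw [List.range_succ, List.map_append] at this
    simp only [List.map_cons, List.map_nil] at this
    simp only [this, Bool.and_true, Bool.and_eq_true, Bool.not_eq_true', List.all_eq_true,
      List.mem_range, List.length_map, List.length_range, beq_iff_eq]
    refine ⟨?_, fun i hi => ?_⟩
    · rw [List.elem_eq_contains]
      simp only [List.contains_eq_mem, List.mem_map, List.mem_range, decide_eq_false_iff_not,
        not_exists, not_and]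
      intro i hi he
      have := hinj i (by omega) m (by omega) he
      omega
    · rw [h i (by omega) m (by omega) (by omega)]
      simp [hi]

theorem extendable_of_iso {n : ℕ} {G : Dgraph (Fin n)} {G' : Dgraph (Fin n)} {a b : ℕ → ℕ → ℕ}
    (ha : ∀ i j : Fin n, i ≠ j → a i j = pairCode G i j)
    (hb : ∀ i j : Fin n, i ≠ j → b i j = pairCode G' i j) (h : Iso G G') :
    extendable a b n n [] = true := by
  obtain ⟨e, he⟩ := h
  refine extendable_of_perm (s := fun i => if hi : i < n then (e ⟨i, hi⟩ : ℕ) else 0)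
    ?_ ?_ ?_ n 0 (by simp)
  · intro i hi
    simp [hi]
  · intro i hi j hj hij
    simp only [hi, hj, dif_pos] at hij
    simpa using e.injective (Fin.ext hij)
  · intro i hi j hj hij
    simp only [hi, hj, dif_pos]
    have hne : (⟨i, hi⟩ : Fin n) ≠ ⟨j, hj⟩ := by simpa using hij
    rw [ha ⟨i, hi⟩ ⟨j, hj⟩ hne, hb _ _ (e.injective.ne hne)]
    exact pairCode_congr (he _ _) (he _ _)

theorem HemiSix.table {G G' : Dgraph V} (h : HemiSix G G') {l : List V} (hl : l.Nodup)
    (hlen : l.length ≤ 6) : hemiTable l.length (table G l) (table G' l) = true := by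
  have key : ∀ (H : Dgraph V) (i j : Fin l.length), i ≠ j →
      entry (Dgraph.table H l) i j = pairCode (comap l.get H) i j := by
    intro H i j hij
    rw [entry_table H l i j i.2 j.2 (by simpa [Fin.ext_iff] using hij)]
    rfl
  unfold hemiTable
  rw [Bool.or_eq_true]
  rcases h _ hlen l.get hl.injective_get with h | h
  · exact Or.inl (extendable_of_iso (key G) (key G') h)
  · exact Or.inr (extendable_of_iso (fun i j hij => key G j i hij.symm) (key G') h)

theorem Iso.refl (G : Dgraph V) : Iso G G := ⟨Equiv.refl V, fun _ _ => Iff.rfl⟩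

theorem Iso.symm {G : Dgraph V} {G' : Dgraph W} (h : Iso G G') : Iso G' G := by
  obtain ⟨e, he⟩ := h
  exact ⟨e.symm, fun x y => by simp [he]⟩

theorem Iso.trans {U : Type*} {G : Dgraph V} {G' : Dgraph W} {G'' : Dgraph U} (h : Iso G G')
    (h' : Iso G' G'') : Iso G G'' := by
  obtain ⟨e, he⟩ := h
  obtain ⟨f, hf⟩ := h'
  exact ⟨e.trans f, fun x y => by rw [he, hf]; rfl⟩

theorem Iso.dual {G : Dgraph V} {G' : Dgraph W} (h : Iso G G') : Iso G.dual G'.dual := by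
  obtain ⟨e, he⟩ := h
  exact ⟨e, fun x y => he y x⟩

theorem Hemi.symm {G : Dgraph V} {G' : Dgraph W} (h : Hemi G G') : Hemi G' G := by
  rcases h with h | h
  · exact Or.inl h.symm
  · exact Or.inr h.symm.dual

theorem Hemi.dual_right {G : Dgraph V} {G' : Dgraph W} (h : Hemi G G') : Hemi G G'.dual := by
  rcases h with h | h
  · exact Or.inr h.dual
  · exact Or.inl h.dual

theorem Hemi.trans_iso {U : Type*} {G : Dgraph V} {G' : Dgraph W} {G'' : Dgraph U}
    (h : Hemi G G') (h' : Iso G' G'') : Hemi G G'' :=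
  h.imp (fun h => h.trans h') (fun h => h.trans h')

theorem HemiSix.symm {G G' : Dgraph V} (h : HemiSix G G') : HemiSix G' G :=
  fun n hn f hf => (h n hn f hf).symm

theorem HemiSix.dual_right {G G' : Dgraph V} (h : HemiSix G G') : HemiSix G G'.dual :=
  fun n hn f hf => (h n hn f hf).dual_right

theorem HemiSix.comap {G G' : Dgraph V} (h : HemiSix G G') {g : W → V}
    (hg : Function.Injective g) : HemiSix (comap g G) (comap g G') :=
  fun n hn f hf => h n hn (g ∘ f) (hg.comp hf)

theorem hemiSix_of_leHemi {G G' : Dgraph V} (h : LeHemi 6 G G') : HemiSix G G' := by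
  intro n hn f hf
  rcases Nat.eq_zero_or_pos n with rfl | hpos
  · exact Or.inl ⟨Equiv.refl _, fun x => x.elim0⟩
  have hX : (Set.range f).ncard = n := by
    rw [← Set.image_univ, Set.ncard_image_of_injective _ hf, Set.ncard_univ]
    simp
  have hiso : ∀ H : Dgraph V, Iso (Dgraph.comap f H) (H.ind (Set.range f)) := fun H =>
    ⟨Equiv.ofInjective f hf, fun _ _ => Iff.rfl⟩
  rcases h n hpos hn _ (Set.finite_range f) hX with h | h
  · exact Or.inl (((hiso G).trans h).trans (hiso G').symm)
  · exact Or.inr (((hiso G).dual.trans h).trans (hiso G').symm)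

/-- Codes of a directed pair with the same orientation in both digraphs. -/
abbrev ParC (a a' : ℕ) : Prop := (a = 1 ∨ a = 2) ∧ a' = a

/-- Codes of a directed pair with opposite orientations in both digraphs. -/
abbrev RevC (a a' : ℕ) : Prop := (a = 1 ∨ a = 2) ∧ a' = swapCode a

/-- Codes of a neutral pair, of the same type in both digraphs. -/
abbrev NtlC (a a' : ℕ) : Prop := (a = 0 ∨ a = 3) ∧ a' = a

/-- The pair is directed, with the same orientation in both digraphs. -/
abbrev Par (G G' : Dgraph V) (x y : V) : Prop := ParC (pairCode G x y) (pairCode G' x y)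

/-- The pair is directed, with opposite orientations in both digraphs. -/
abbrev Rev (G G' : Dgraph V) (x y : V) : Prop := RevC (pairCode G x y) (pairCode G' x y)

/-- The pair is neutral or a singleton, of the same type in both digraphs. -/
abbrev Ntl (G G' : Dgraph V) (x y : V) : Prop := NtlC (pairCode G x y) (pairCode G' x y)

/-- The type of a pair as an element of `Fin 4`. -/
noncomputable def pairFin (G : Dgraph V) (x y : V) : Fin 4 := ⟨pairCode G x y, pairCode_lt G x y⟩

theorem pairCode_self (G : Dgraph V) (x : V) : pairCode G x x = 0 := by
  simp [pairCode, G.irrefl]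

theorem pairCode_eq_one {G : Dgraph V} {x y : V} :
    pairCode G x y = 1 ↔ G.Arc x y ∧ ¬ G.Arc y x := by
  unfold pairCode
  split_ifs <;> simp_all

theorem pairCode_eq_two {G : Dgraph V} {x y : V} :
    pairCode G x y = 2 ↔ G.Arc y x ∧ ¬ G.Arc x y := by
  unfold pairCode
  split_ifs <;> simp_all

theorem pairCode_eq_three {G : Dgraph V} {x y : V} :
    pairCode G x y = 3 ↔ G.Arc x y ∧ G.Arc y x := by
  unfold pairCode
  split_ifs <;> simp_all

theorem pairCode_eq_zero {G : Dgraph V} {x y : V} :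
    pairCode G x y = 0 ↔ ¬ G.Arc x y ∧ ¬ G.Arc y x := by
  unfold pairCode
  split_ifs <;> simp_all

theorem arc_iff_pairCode {G : Dgraph V} {x y : V} :
    G.Arc x y ↔ pairCode G x y = 1 ∨ pairCode G x y = 3 := by
  rw [pairCode_eq_one, pairCode_eq_three]
  tauto

theorem dir_iff_pairCode {G : Dgraph V} {x y : V} :
    G.Dir x y ↔ pairCode G x y = 1 ∨ pairCode G x y = 2 := by
  rw [pairCode_eq_one, pairCode_eq_two]
  rfl

theorem arc_iff_of_pairCode_eq {G : Dgraph V} {G' : Dgraph W} {x y : V} {x' y' : W}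
    (h : pairCode G x y = pairCode G' x' y') : G.Arc x y ↔ G'.Arc x' y' := by
  rw [arc_iff_pairCode, arc_iff_pairCode, h]

theorem pairCode_dual (G : Dgraph V) (x y : V) :
    pairCode G.dual x y = swapCode (pairCode G x y) := by
  rw [← pairCode_swap]
  rfl

theorem ne_of_dirCode {G : Dgraph V} {x y : V} (h : pairCode G x y = 1 ∨ pairCode G x y = 2) :
    x ≠ y := by
  rintro rfl
  simp [pairCode_self] at h

theorem swapCode_swapCode (a : ℕ) : swapCode (swapCode a) = a := by
  match a with
  | 0 => rfl
  | 1 => rfl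
  | 2 => rfl
  | n + 3 => rfl

theorem swapCode_dir {a : ℕ} (h : a = 1 ∨ a = 2) : swapCode a = 1 ∨ swapCode a = 2 := by
  rcases h with rfl | rfl <;> simp [swapCode]

section Symmetry

variable {G G' : Dgraph V} {x y : V}

theorem Par.symm (h : Par G G' x y) : Par G G' y x := by
  unfold Par ParC at *
  rw [pairCode_swap G x y, pairCode_swap G' x y, h.2]
  exact ⟨swapCode_dir h.1, rfl⟩

theorem Rev.symm (h : Rev G G' x y) : Rev G G' y x := by
  unfold Rev RevC at *
  rw [pairCode_swap G x y, pairCode_swap G' x y, h.2]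
  exact ⟨swapCode_dir h.1, rfl⟩

theorem Ntl.symm (h : Ntl G G' x y) : Ntl G G' y x := by
  unfold Ntl NtlC at *
  rw [pairCode_swap G x y, pairCode_swap G' x y, h.2]
  rcases h.1 with h | h <;> simp [h, swapCode]

theorem Par.ne (h : Par G G' x y) : x ≠ y := ne_of_dirCode h.1

theorem Rev.ne (h : Rev G G' x y) : x ≠ y := ne_of_dirCode h.1

theorem par_dual : Par G G'.dual x y ↔ Rev G G' x y := by
  unfold Par Rev ParC RevC
  rw [pairCode_dual]
  refine and_congr_right fun _ => ⟨fun h => ?_, fun h => ?_⟩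
  · rw [← h, swapCode_swapCode]
  · rw [h, swapCode_swapCode]

theorem rev_dual : Rev G G'.dual x y ↔ Par G G' x y := by
  unfold Par Rev ParC RevC
  rw [pairCode_dual]
  refine and_congr_right fun _ => ⟨fun h => ?_, fun h => ?_⟩
  · rw [← swapCode_swapCode (pairCode G' x y), h, swapCode_swapCode]
  · rw [h]

end Symmetry

theorem pair_code_cases : ∀ a a' : Fin 4, hemiTable 2 [[a], []] [[a'], []] = true →
    ParC a a' ∨ RevC a a' ∨ NtlC a a' := by
  decide +kernel

section Small

variable {G G' : Dgraph V} (h : HemiSix G G')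
include h

theorem HemiSix.cases (x y : V) : Par G G' x y ∨ Rev G G' x y ∨ Ntl G G' x y := by
  by_cases hxy : x = y
  · subst hxy
    refine Or.inr (Or.inr ?_)
    simp [Ntl, NtlC, pairCode_self]
  · exact pair_code_cases (pairFin G x y) (pairFin G' x y) (h.table (l := [x, y]) (by simp [hxy])
      (by simp))

end Small

section Tables

set_option synthInstance.maxHeartbeats 400000
set_option synthInstance.maxSize 2000
set_option maxRecDepth 4000

theorem rain_codes : ∀ a a' : Fin 4, ParC a a' → ∀ b b' : Fin 4, RevC b b' → ∀ c c' : Fin 4,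
    hemiTable 3 [[a, b], [c], []] [[a', b'], [c'], []] = true → (c : ℕ) = 1 ∨ (c : ℕ) = 2 := by
  decide +kernel

theorem tri_codes : ∀ a a' : Fin 4, ParC a a' → ∀ b b' : Fin 4, ParC b b' →
    ∀ c c' : Fin 4, RevC c c' →
    hemiTable 3 [[a, b], [c], []] [[a', b'], [c'], []] = true → (a : ℕ) = b := by
  decide +kernel

theorem flag_codes : ∀ k k' : Fin 4, ParC k k' → ∀ e e' : Fin 4, (ParC e e' ∨ NtlC e e') →
    ∀ m m' : Fin 4, RevC m m' →
    hemiTable 4 [[e, k, k], [3, 0], [m], []] [[e', k', k'], [3, 0], [m'], []] = false := by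
  decide +kernel

theorem peak_codes : ∀ k k' : Fin 4, ParC k k' → ∀ n n' : Fin 4, NtlC n n' →
    ∀ m m' : Fin 4, RevC m m' →
    hemiTable 4 [[k, k, k], [m, m], [n], []] [[k', k', k'], [m', m'], [n'], []] = false := by
  decide +kernel

theorem diamond_codes : ∀ k k' : Fin 4, ParC k k' → ∀ m m' : Fin 4, RevC m m' →
    ∀ c c' : Fin 4, (ParC c c' ∨ RevC c c') →
    hemiTable 5 [[k, k, k, k], [m, m, m], [c, swapCode c], [c], []]
      [[k', k', k', k'], [m', m', m'], [c', swapCode c'], [c'], []] = false := by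
  decide +kernel

/-- The list `w, v, x, y`. -/
theorem peak_step_codes : ∀ k k' : Fin 4, ParC k k' → ∀ m m' : Fin 4, RevC m m' →
    ∀ n n' : Fin 4, NtlC n n' → ∀ a a' : Fin 4, (ParC a a' ∨ RevC a a') →
    ∀ b b' : Fin 4, (ParC b b' ∨ RevC b b') →
    hemiTable 3 [[m, k], [a], []] [[m', k'], [a'], []] = true →
    hemiTable 3 [[m, k], [b], []] [[m', k'], [b'], []] = true →
    hemiTable 3 [[a, b], [n], []] [[a', b'], [n'], []] = true →
    hemiTable 4 [[m, k, k], [a, b], [n], []] [[m', k', k'], [a', b'], [n'], []] = true →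
    ParC a a' ∧ ParC b b' ∧ (a : ℕ) = k ∧ (b : ℕ) = k := by
  decide +kernel

/-- The list `w, v, x, y`. -/
theorem path_step_codes : ∀ k k' : Fin 4, ParC k k' → ∀ m m' : Fin 4, RevC m m' →
    ∀ n n' : Fin 4, NtlC n n' → ∀ a a' : Fin 4, (ParC a a' ∨ RevC a a') →
    ∀ b b' : Fin 4, (ParC b b' ∨ RevC b b') →
    hemiTable 3 [[m, k], [a], []] [[m', k'], [a'], []] = true →
    hemiTable 3 [[m, swapCode k], [b], []] [[m', swapCode k'], [b'], []] = true →
    hemiTable 3 [[a, b], [n], []] [[a', b'], [n'], []] = true →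
    hemiTable 4 [[m, k, swapCode k], [a, b], [n], []]
      [[m', k', swapCode k'], [a', b'], [n'], []] = true →
    (ParC a a' ∧ ParC b b' ∧ (a : ℕ) = k ∧ (b : ℕ) = swapCode k) ∨
      (RevC a a' ∧ RevC b b' ∧ (a : ℕ) = b) := by
  decide +kernel

/-- The list `w, v, x, y, z`. -/
theorem diamond_step_codes : ∀ k k' : Fin 4, ParC k k' → ∀ m m' : Fin 4, RevC m m' →
    ∀ c c' : Fin 4, (ParC c c' ∨ RevC c c') → ∀ a a' : Fin 4, (ParC a a' ∨ RevC a a') →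
    hemiTable 3 [[m, k], [a], []] [[m', k'], [a'], []] = true →
    ∀ b b' : Fin 4, (ParC b b' ∨ RevC b b') →
    hemiTable 3 [[m, k], [b], []] [[m', k'], [b'], []] = true →
    hemiTable 3 [[a, b], [c], []] [[a', b'], [c'], []] = true →
    ∀ d d' : Fin 4, (ParC d d' ∨ RevC d d') →
    hemiTable 3 [[m, k], [d], []] [[m', k'], [d'], []] = true →
    hemiTable 4 [[a, b, d], [c, swapCode c], [c], []]
      [[a', b', d'], [c', swapCode c'], [c'], []] = true →
    hemiTable 5 [[m, k, k, k], [a, b, d], [c, swapCode c], [c], []]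
      [[m', k', k', k'], [a', b', d'], [c', swapCode c'], [c'], []] = true →
    ParC a a' ∧ ParC b b' ∧ ParC d d' ∧ (a : ℕ) = k ∧ (b : ℕ) = k ∧ (d : ℕ) = k := by
  decide +kernel

/-- The list `v, x, y, z`. -/
theorem cycle_step_codes : ∀ c c' : Fin 4, ParC c c' → ∀ m m' : Fin 4, RevC m m' →
    ∀ b b' : Fin 4, (ParC b b' ∨ RevC b b') →
    hemiTable 3 [[m, b], [c], []] [[m', b'], [c'], []] = true →
    ∀ d d' : Fin 4, (ParC d d' ∨ RevC d d') →
    hemiTable 3 [[b, d], [c], []] [[b', d'], [c'], []] = true →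
    hemiTable 3 [[m, d], [swapCode c], []] [[m', d'], [swapCode c'], []] = true →
    hemiTable 4 [[m, b, d], [c, swapCode c], [c], []]
      [[m', b', d'], [c', swapCode c'], [c'], []] = true →
    ((m : ℕ) = b ∧ (b : ℕ) = d ∧ RevC b b' ∧ RevC d d') ∨
      (ParC b b' ∧ ParC d d' ∧ (b : ℕ) = c ∧ (d : ℕ) = swapCode c) := by
  decide +kernel

/-- The list `x, y, z` for cycles. -/
theorem cycle_status_codes : ∀ c c' : Fin 4, (ParC c c' ∨ RevC c c' ) →
    (c : ℕ) = 1 ∨ (c : ℕ) = 2 → ∀ a' b' : Fin 4,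
    hemiTable 3 [[c, swapCode c], [c], []] [[c', a'], [b'], []] = true →
    (a' : ℕ) = swapCode c' ∧ (b' : ℕ) = c' := by
  decide +kernel

end Tables

theorem swapCode_ne_zero {a : ℕ} (h : a = 1 ∨ a = 2) : swapCode a ≠ a := by
  rcases h with rfl | rfl <;> simp [swapCode]

section Statuses

variable {G G' : Dgraph V} {x y z : V}

theorem Par.not_rev (h : Par G G' x y) : ¬ Rev G G' x y := fun h' =>
  swapCode_ne_zero h.1 (h'.2.symm.trans h.2)

theorem Par.not_ntl (h : Par G G' x y) : ¬ Ntl G G' x y := by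
  rintro ⟨h', -⟩
  have := h.1
  omega

theorem Rev.not_ntl (h : Rev G G' x y) : ¬ Ntl G G' x y := by
  rintro ⟨h', -⟩
  have := h.1
  omega

theorem par_dual_eq : Par G G'.dual = Rev G G' := by
  funext x y
  exact propext par_dual

theorem rev_dual_eq : Rev G G'.dual = Par G G' := by
  funext x y
  exact propext rev_dual

theorem ntl_dual : Ntl G G'.dual x y ↔ Ntl G G' x y := by
  unfold Ntl NtlC
  rw [pairCode_dual]
  refine and_congr_right fun h => ?_
  generalize pairCode G' x y = b at *
  rcases h with h | h <;> rw [h] <;> constructor <;> intro h' <;>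
    first | (rw [h']; rfl) | (rw [← swapCode_swapCode b, h']; rfl)

end Statuses

section Consequences

variable {G G' : Dgraph V} (h : HemiSix G G') {x y z w : V}
include h

theorem HemiSix.par_or_rev (hd : pairCode G x y = 1 ∨ pairCode G x y = 2) :
    Par G G' x y ∨ Rev G G' x y := by
  rcases h.cases x y with h1 | h1 | h1
  · exact Or.inl h1
  · exact Or.inr h1
  · have := h1.1
    omega

theorem HemiSix.dir_of_par_rev (hxy : Par G G' x y) (hxz : Rev G G' x z) :
    Par G G' y z ∨ Rev G G' y z := by
  have hne : y ≠ z := by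
    rintro rfl
    exact hxy.not_rev hxz
  exact h.par_or_rev <| rain_codes (pairFin G x y) (pairFin G' x y) hxy
    (pairFin G x z) (pairFin G' x z) hxz (pairFin G y z) (pairFin G' y z)
    (h.table (l := [x, y, z]) (by simp [hne, hxy.ne, hxz.ne]) (by simp))

theorem HemiSix.code_eq_of_par (hxy : Par G G' x y) (hxz : Par G G' x z) (hyz : Rev G G' y z) :
    pairCode G x y = pairCode G x z :=
  tri_codes (pairFin G x y) (pairFin G' x y) hxy (pairFin G x z) (pairFin G' x z) hxz
    (pairFin G y z) (pairFin G' y z) hyz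
    (h.table (l := [x, y, z]) (by simp [hyz.ne, hxy.ne, hxz.ne]) (by simp))

theorem HemiSix.flag_false (hzx : Par G G' z x ∨ Ntl G G' z x) (hne : z ≠ x) (hzy : Par G G' z y)
    (hzw : Par G G' z w) (hk : pairCode G z y = pairCode G z w) (hyw : Rev G G' y w)
    (hxy : pairCode G x y = 3) (hxw : pairCode G x w = 0) (hxy' : pairCode G' x y = 3)
    (hxw' : pairCode G' x w = 0) : False := by
  have hxy0 : x ≠ y := by
    rintro rfl
    simp [pairCode_self] at hxy
  have hxw0 : x ≠ w := by
    rintro rfl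
    have := hyw.symm.1
    omega
  have := h.table (l := [z, x, y, w]) (by simp [hne, hzy.ne, hzw.ne, hyw.ne, hxy0, hxw0])
    (by simp)
  simp only [Dgraph.table, List.map, ← hk, hzw.2, hzy.2, hxy, hxw, hxy', hxw'] at this
  have h0 := flag_codes (pairFin G z y) (pairFin G z y) ⟨hzy.1, rfl⟩ (pairFin G z x)
    (pairFin G' z x) hzx (pairFin G y w) (pairFin G' y w) hyw
  simp only [pairFin] at h0
  exact Bool.false_ne_true (h0.symm.trans this)

theorem HemiSix.peak_false {k : ℕ} (hzx : Par G G' z x) (hzy : Par G G' z y)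
    (hzw : Par G G' z w) (kx : pairCode G z x = k) (ky : pairCode G z y = k)
    (kw : pairCode G z w = k) (hxy : Rev G G' x y) (hxw : Rev G G' x w)
    (hm : pairCode G x y = pairCode G x w) (hne : y ≠ w) (hyw : Ntl G G' y w) : False := by
  subst kw
  have := h.table (l := [z, x, y, w]) (by simp [hne, hzx.ne, hzy.ne, hzw.ne, hxy.ne, hxw.ne])
    (by simp)
  simp only [Dgraph.table, List.map, hzw.2, hzy.2, hzx.2, kx, ky, hxy.2, hxw.2, ← hm] at this
  have h0 := peak_codes (pairFin G z w) (pairFin G z w) ⟨hzw.1, rfl⟩ (pairFin G y w)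
    (pairFin G' y w) hyw (pairFin G x y) (pairFin G' x y) hxy
  simp only [pairFin, hxy.2] at h0
  exact Bool.false_ne_true (h0.symm.trans this)

theorem HemiSix.cycle_status {c : ℕ} (hc : c = 1 ∨ c = 2) (h1 : pairCode G x y = c)
    (h2 : pairCode G x z = swapCode c) (h3 : pairCode G y z = c) :
    pairCode G' x z = swapCode (pairCode G' x y) ∧ pairCode G' y z = pairCode G' x y := by
  subst h1
  have hxy : x ≠ y := ne_of_dirCode hc
  have hxz : x ≠ z := ne_of_dirCode (by rw [h2]; exact swapCode_dir hc)
  have hyz : y ≠ z := ne_of_dirCode (by rw [h3]; exact hc)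
  have := h.table (l := [x, y, z]) (by simp [*]) (by simp)
  simp only [Dgraph.table, List.map, h2, h3] at this
  exact cycle_status_codes (pairFin G x y) (pairFin G' x y) (h.par_or_rev hc) hc
    (pairFin G' x z) (pairFin G' y z) this

theorem HemiSix.diamond_false {k c : ℕ} (hzx : Par G G' z x) {t₀ t₁ t₂ : V}
    (h0 : Par G G' z t₀) (h1 : Par G G' z t₁) (h2 : Par G G' z t₂) (kx : pairCode G z x = k)
    (k0 : pairCode G z t₀ = k) (k1 : pairCode G z t₁ = k) (k2 : pairCode G z t₂ = k)
    (hx0 : Rev G G' x t₀) (hx1 : Rev G G' x t₁) (hx2 : Rev G G' x t₂)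
    (m1 : pairCode G x t₁ = pairCode G x t₀) (m2 : pairCode G x t₂ = pairCode G x t₀)
    (hc : c = 1 ∨ c = 2) (c1 : pairCode G t₀ t₁ = c)
    (c2 : pairCode G t₀ t₂ = swapCode c) (c3 : pairCode G t₁ t₂ = c) : False := by
  subst kx
  subst c1
  have hs := h.cycle_status hc rfl c2 c3
  have h02 : t₀ ≠ t₂ := ne_of_dirCode (by rw [c2]; exact swapCode_dir hc)
  have h12 : t₁ ≠ t₂ := ne_of_dirCode (by rw [c3]; exact hc)
  have := h.table (l := [z, x, t₀, t₁, t₂]) (by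
    simp [hzx.ne, h0.ne, h1.ne, h2.ne, hx0.ne, hx1.ne, hx2.ne, ne_of_dirCode hc, h02, h12])
    (by simp)
  simp only [Dgraph.table, List.map, hzx.2, h0.2, h1.2, h2.2, k0, k1, k2, hx0.2, hx1.2, hx2.2, m1,
    m2, c2, c3, hs.1, hs.2] at this
  have h0 := diamond_codes (pairFin G z x) (pairFin G z x) ⟨hzx.1, rfl⟩ (pairFin G x t₀)
    (pairFin G' x t₀) hx0 (pairFin G t₀ t₁) (pairFin G' t₀ t₁) (h.par_or_rev hc)
  simp only [pairFin, hx0.2] at h0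
  exact Bool.false_ne_true (h0.symm.trans this)

end Consequences

/-- The class of `c` under reachability through reversed pairs. -/
def revClass (G G' : Dgraph V) (c : V) : Set V := {y | Relation.ReflTransGen (Rev G G') c y}

section RevClass

variable {G G' : Dgraph V} (h : HemiSix G G') {c x : V}

theorem not_rev_of_notMem (hx : x ∉ revClass G G' c) {y : V} (hy : y ∈ revClass G G' c) :
    ¬ Rev G G' x y := fun hr => hx (Relation.ReflTransGen.tail hy hr.symm)

include h

theorem HemiSix.revClass_par (hx : x ∉ revClass G G' c) (hxc : Par G G' x c) {y : V}
    (hy : y ∈ revClass G G' c) : Par G G' x y ∧ pairCode G x y = pairCode G x c := by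
  induction hy with
  | refl => exact ⟨hxc, rfl⟩
  | @tail y z hy hyz ih =>
    have hz : z ∈ revClass G G' c := Relation.ReflTransGen.tail hy hyz
    have hp : Par G G' x z :=
      (h.dir_of_par_rev ih.1.symm hyz).resolve_right (not_rev_of_notMem hx hz)
    exact ⟨hp, (h.code_eq_of_par ih.1 hp hyz).symm.trans ih.2⟩

theorem HemiSix.revClass_ntl (hx : x ∉ revClass G G' c) (hxc : Ntl G G' x c) {y : V}
    (hy : y ∈ revClass G G' c) : Ntl G G' x y := by
  induction hy with
  | refl => exact hxc
  | @tail y z hy hyz ih =>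
    have hz : z ∈ revClass G G' c := Relation.ReflTransGen.tail hy hyz
    rcases h.cases x z with h1 | h1 | h1
    · rcases h.dir_of_par_rev h1.symm hyz.symm with h2 | h2
      · exact absurd ih h2.not_ntl
      · exact absurd ih h2.not_ntl
    · exact absurd h1 (not_rev_of_notMem hx hz)
    · exact h1

theorem HemiSix.exists_par (hG : G.ArcConnected) (hc : revClass G G' c ≠ Set.univ) :
    ∃ z, z ∉ revClass G G' c ∧ Par G G' z c := by
  by_contra! hno
  apply hc
  refine Set.eq_univ_of_forall fun y => ?_
  have hy := hG c y
  induction hy with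
  | refl => exact Relation.ReflTransGen.refl
  | @tail y z _ hyz ih =>
    by_contra hz
    rcases h.cases z c with h1 | h1 | h1
    · exact hno z hz h1
    · exact not_rev_of_notMem hz Relation.ReflTransGen.refl h1
    · have h2 := (h.revClass_ntl hz h1 ih).symm
      have := h2.1
      rw [dir_iff_pairCode] at hyz
      omega

/-- A class of the reversal relation is an interval dominated uniformly by some vertex. -/
theorem HemiSix.revClass_interval (hG : G.ArcConnected) (hc : revClass G G' c ≠ Set.univ) :
    (∃ z k, ∀ y ∈ revClass G G' c, Par G G' z y ∧ pairCode G z y = k) ∧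
      ∀ x ∉ revClass G G' c, ∃ j, ∀ y ∈ revClass G G' c,
        pairCode G x y = j ∧ pairCode G' x y = j := by
  obtain ⟨z, hz, hzc⟩ := h.exists_par hG hc
  have hzy := fun y (hy : y ∈ revClass G G' c) => h.revClass_par hz hzc hy
  refine ⟨⟨z, _, hzy⟩, fun x hx => ?_⟩
  rcases h.cases x c with h1 | h1 | h1
  · refine ⟨pairCode G x c, fun y hy => ?_⟩
    have := h.revClass_par hx h1 hy
    exact ⟨this.2, this.1.2.trans this.2⟩
  · exact absurd h1 (not_rev_of_notMem hx Relation.ReflTransGen.refl)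
  · refine ⟨pairCode G x c, fun y hy => ?_⟩
    have hn := fun y (hy : y ∈ revClass G G' c) => h.revClass_ntl hx h1 hy
    suffices hs : pairCode G x y = pairCode G x c from ⟨hs, (hn y hy).2.trans hs⟩
    induction hy with
    | refl => rfl
    | @tail y w hy hyw ih =>
      rw [← ih]
      have hw : w ∈ revClass G G' c := Relation.ReflTransGen.tail hy hyw
      have hzx : Par G G' z x ∨ Ntl G G' z x := by
        rcases h.cases z x with h2 | h2 | h2
        · exact Or.inl h2
        · rcases h.dir_of_par_rev (hzy y hy).1 h2 with h3 | h3
          · exact absurd (hn y hy).symm h3.not_ntl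
          · exact absurd (hn y hy).symm h3.not_ntl
        · exact Or.inr h2
      have hne : z ≠ x := by
        rintro rfl
        exact hzc.not_ntl h1
      have hk := (hzy y hy).2.trans (hzy w hw).2.symm
      rcases (hn y hy).1 with e1 | e1 <;> rcases (hn w hw).1 with e2 | e2
      · rw [e1, e2]
      · exact (h.flag_false hzx hne (hzy w hw).1 (hzy y hy).1 hk.symm hyw.symm e2 e1
          ((hn w hw).2.trans e2) ((hn y hy).2.trans e1)).elim
      · exact (h.flag_false hzx hne (hzy y hy).1 (hzy w hw).1 hk hyw e1 e2
          ((hn y hy).2.trans e1) ((hn w hw).2.trans e2)).elim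
      · rw [e1, e2]

end RevClass

theorem eq_swapCode_of_ne {a b : ℕ} (ha : a = 1 ∨ a = 2) (hb : b = 1 ∨ b = 2) (h : a ≠ b) :
    b = swapCode a := by
  rcases ha with rfl | rfl <;> rcases hb with rfl | rfl <;> simp_all [swapCode]

section Connected

variable {G G' : Dgraph V} (h : HemiSix G G') {x y z w : V}
include h

theorem HemiSix.no_par_peak (hM : ∀ x y, Relation.ReflTransGen (Rev G G') x y) (hne : x ≠ y)
    (hxy : Ntl G G' x y) (hx : Par G G' w x) (hy : Par G G' w y) :
    pairCode G w x ≠ pairCode G w y := by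
  intro hk
  have key : ∀ v, Relation.ReflTransGen (Rev G G') w v →
      Par G G' v x ∧ Par G G' v y ∧ pairCode G v x = pairCode G v y := by
    intro v hv
    induction hv with
    | refl => exact ⟨hx, hy, hk⟩
    | @tail w v _ hwv ih =>
      obtain ⟨hx, hy, hk⟩ := ih
      have hvx := h.dir_of_par_rev hx hwv
      have hvy := h.dir_of_par_rev hy hwv
      have hvx' := hvx.imp Par.symm Rev.symm
      have hvy' := hvy.imp Par.symm Rev.symm
      have nx : v ≠ x := (hvx'.elim Par.ne Rev.ne)
      have ny : v ≠ y := (hvy'.elim Par.ne Rev.ne)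
      have h4 := h.table (l := [w, v, x, y]) (by simp [hx.ne, hy.ne, hwv.ne, nx, ny, hne])
        (by simp)
      have h3 := h.table (l := [w, v, x]) (by simp [hx.ne, hwv.ne, nx]) (by simp)
      have h3' := h.table (l := [w, v, y]) (by simp [hy.ne, hwv.ne, ny]) (by simp)
      have h3'' := h.table (l := [v, x, y]) (by simp [nx, ny, hne]) (by simp)
      simp only [Dgraph.table, List.map, hy.2, hx.2, ← hk] at h4 h3 h3' h3''
      have := peak_step_codes (pairFin G w x) (pairFin G w x) ⟨hx.1, rfl⟩ (pairFin G w v)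
        (pairFin G' w v) hwv (pairFin G x y) (pairFin G' x y) hxy (pairFin G v x) (pairFin G' v x)
        hvx' (pairFin G v y) (pairFin G' v y) hvy' h3 h3' h3'' h4
      exact ⟨this.1, this.2.1, this.2.2.1.trans this.2.2.2.symm⟩
  exact (key x (hM w x)).1.ne rfl

theorem HemiSix.no_rev_peak (hP : ∀ x y, Relation.ReflTransGen (Par G G') x y) (hne : x ≠ y)
    (hxy : Ntl G G' x y) (hx : Rev G G' w x) (hy : Rev G G' w y) :
    pairCode G w x ≠ pairCode G w y :=
  h.dual_right.no_par_peak (by rwa [rev_dual_eq]) hne (ntl_dual.2 hxy) (par_dual.2 hx)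
    (par_dual.2 hy)

theorem HemiSix.no_par_join (hP : ∀ x y, Relation.ReflTransGen (Par G G') x y)
    (hM : ∀ x y, Relation.ReflTransGen (Rev G G') x y) (hne : x ≠ y)
    (hxy : Ntl G G' x y) (hx : Par G G' w x) : ¬ Par G G' w y := by
  intro hy
  have key : ∀ v, Relation.ReflTransGen (Rev G G') w v → Par G G' v x ∧ Par G G' v y := by
    intro v hv
    induction hv with
    | refl => exact ⟨hx, hy⟩
    | @tail w v _ hwv ih =>
      obtain ⟨hx, hy⟩ := ih
      have hk : pairCode G w y = swapCode (pairCode G w x) := 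
        eq_swapCode_of_ne hx.1 hy.1 (h.no_par_peak hM hne hxy hx hy)
      have hvx' := (h.dir_of_par_rev hx hwv).imp Par.symm Rev.symm
      have hvy' := (h.dir_of_par_rev hy hwv).imp Par.symm Rev.symm
      have nx : v ≠ x := (hvx'.elim Par.ne Rev.ne)
      have ny : v ≠ y := (hvy'.elim Par.ne Rev.ne)
      have h4 := h.table (l := [w, v, x, y]) (by simp [hx.ne, hy.ne, hwv.ne, nx, ny, hne])
        (by simp)
      have h3 := h.table (l := [w, v, x]) (by simp [hx.ne, hwv.ne, nx]) (by simp)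
      have h3' := h.table (l := [w, v, y]) (by simp [hy.ne, hwv.ne, ny]) (by simp)
      have h3'' := h.table (l := [v, x, y]) (by simp [nx, ny, hne]) (by simp)
      simp only [Dgraph.table, List.map, hy.2, hx.2, hk] at h4 h3 h3' h3''
      rcases path_step_codes (pairFin G w x) (pairFin G w x) ⟨hx.1, rfl⟩ (pairFin G w v)
        (pairFin G' w v) hwv (pairFin G x y) (pairFin G' x y) hxy (pairFin G v x) (pairFin G' v x)
        hvx' (pairFin G v y) (pairFin G' v y) hvy' h3 h3' h3'' h4 with h5 | h5
      · exact ⟨h5.1, h5.2.1⟩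
      · exact absurd h5.2.2 (h.no_rev_peak hP hne hxy h5.1 h5.2.1)
  exact (key x (hM w x)).1.ne rfl

theorem HemiSix.isTournament (hG : G.ArcConnected)
    (hP : ∀ x y, Relation.ReflTransGen (Par G G') x y)
    (hM : ∀ x y, Relation.ReflTransGen (Rev G G') x y) : G.IsTournament := by
  intro x y hne
  have key : ∀ v, G.ACRel x v → v = x ∨ G.Dir x v := by
    intro v hv
    induction hv with
    | refl => exact Or.inl rfl
    | @tail v v' _ hvv ih =>
      rcases ih with rfl | ih
      · exact Or.inr hvv
      by_contra! hcon
      have hn : Ntl G G' x v' := by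
        rcases h.cases x v' with h1 | h1 | h1
        · exact absurd (dir_iff_pairCode.2 h1.1) hcon.2
        · exact absurd (dir_iff_pairCode.2 h1.1) hcon.2
        · exact h1
      have h1 := (h.par_or_rev (dir_iff_pairCode.1 ih)).imp Par.symm Rev.symm
      have h2 := h.par_or_rev (dir_iff_pairCode.1 hvv)
      rcases h1 with h1 | h1 <;> rcases h2 with h2 | h2
      · exact h.no_par_join hP hM hcon.1.symm hn h1 h2
      · exact (h.dir_of_par_rev h1 h2).elim (fun h => h.not_ntl hn) (fun h => h.not_ntl hn)
      · exact (h.dir_of_par_rev h2 h1).elim (fun h => h.not_ntl hn.symm)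
          (fun h => h.not_ntl hn.symm)
      · exact h.dual_right.no_par_join (by rwa [par_dual_eq]) (by rwa [rev_dual_eq]) hcon.1.symm
          (ntl_dual.2 hn) (par_dual.2 h1) (par_dual.2 h2)
  exact (key y (hG x y)).resolve_left hne.symm

theorem HemiSix.no_par_diamond
    (hM : ∀ x y, Relation.ReflTransGen (Rev G G') x y) {c : ℕ} (hc : c = 1 ∨ c = 2)
    (c1 : pairCode G x y = c) (c2 : pairCode G x z = swapCode c) (c3 : pairCode G y z = c)
    (hx : Par G G' w x) (hy : Par G G' w y) (hz : Par G G' w z)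
    (ky : pairCode G w y = pairCode G w x) (kz : pairCode G w z = pairCode G w x) : False := by
  subst c1
  have hs := h.cycle_status hc rfl c2 c3
  have hxy : x ≠ y := ne_of_dirCode hc
  have hxz : x ≠ z := ne_of_dirCode (by rw [c2]; exact swapCode_dir hc)
  have hyz : y ≠ z := ne_of_dirCode (by rw [c3]; exact hc)
  have key : ∀ v, Relation.ReflTransGen (Rev G G') w v →
      Par G G' v x ∧ Par G G' v y ∧ Par G G' v z ∧ pairCode G v y = pairCode G v x ∧
        pairCode G v z = pairCode G v x := by
    intro v hv
    induction hv with
    | refl => exact ⟨hx, hy, hz, ky, kz⟩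
    | @tail w v _ hwv ih =>
      obtain ⟨hx, hy, hz, ky, kz⟩ := ih
      have hd : ∀ u, Par G G' w u → Par G G' v u ∨ Rev G G' v u := fun u hu =>
        (h.dir_of_par_rev hu hwv).imp Par.symm Rev.symm
      have nx : v ≠ x := ((hd x hx).elim Par.ne Rev.ne)
      have ny : v ≠ y := ((hd y hy).elim Par.ne Rev.ne)
      have nz : v ≠ z := ((hd z hz).elim Par.ne Rev.ne)
      have g1 := h.table (l := [w, v, x]) (by simp [hx.ne, hwv.ne, nx]) (by simp)
      have g2 := h.table (l := [w, v, y]) (by simp [hy.ne, hwv.ne, ny]) (by simp)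
      have g3 := h.table (l := [v, x, y]) (by simp [nx, ny, hxy]) (by simp)
      have g4 := h.table (l := [w, v, z]) (by simp [hz.ne, hwv.ne, nz]) (by simp)
      have g5 := h.table (l := [v, x, y, z]) (by simp [nx, ny, nz, hxy, hxz, hyz]) (by simp)
      have g6 := h.table (l := [w, v, x, y, z])
        (by simp [hx.ne, hy.ne, hz.ne, hwv.ne, nx, ny, nz, hxy, hxz, hyz]) (by simp)
      simp only [Dgraph.table, List.map, hy.2, hx.2, hz.2, ky, kz, c2, c3, hs.1, hs.2]
        at g1 g2 g3 g4 g5 g6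
      have := diamond_step_codes (pairFin G w x) (pairFin G w x) ⟨hx.1, rfl⟩ (pairFin G w v)
        (pairFin G' w v) hwv (pairFin G x y) (pairFin G' x y) (h.par_or_rev hc) (pairFin G v x)
        (pairFin G' v x) (hd x hx) g1 (pairFin G v y) (pairFin G' v y) (hd y hy) g2 g3
        (pairFin G v z) (pairFin G' v z) (hd z hz) g4 g5 g6
      obtain ⟨i1, i2, i3, i4, i5, i6⟩ := this
      exact ⟨i1, i2, i3, i5.trans i4.symm, i6.trans i4.symm⟩
  exact (key x (hM w x)).1.ne rfl

theorem HemiSix.no_par_cycle (hG : G.IsTournament)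
    (hP : ∀ x y, Relation.ReflTransGen (Par G G') x y)
    (hM : ∀ x y, Relation.ReflTransGen (Rev G G') x y) {c : ℕ}
    (c1 : pairCode G x y = c) (c2 : pairCode G x z = swapCode c) (c3 : pairCode G y z = c)
    (hx : Par G G' x y) : False := by
  have hy : Par G G' y z := by
    have hs := h.cycle_status (c1 ▸ hx.1) c1 c2 c3
    exact ⟨by rw [c3, ← c1]; exact hx.1, by rw [hs.2, hx.2, c1, c3]⟩
  have hxz : Par G G' x z := by
    have hs := h.cycle_status (c1 ▸ hx.1) c1 c2 c3
    exact ⟨by rw [c2, ← c1]; exact swapCode_dir hx.1, by rw [hs.1, hx.2, c1, c2]⟩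
  have key : ∀ v, Relation.ReflTransGen (Rev G G') x v →
      Par G G' v y ∧ Par G G' v z ∧ pairCode G v y = c ∧ pairCode G v z = swapCode c := by
    intro v hv
    induction hv with
    | refl => exact ⟨hx, hxz, c1, c2⟩
    | @tail w v _ hwv ih =>
      obtain ⟨iy, iz, e1, e2⟩ := ih
      subst e1
      have ny : v ≠ y := by
        rintro rfl
        exact iy.not_rev hwv
      have nz : v ≠ z := by
        rintro rfl
        exact iz.not_rev hwv
      have hvy := h.par_or_rev (dir_iff_pairCode.1 (hG v y ny))
      have hvz := h.par_or_rev (dir_iff_pairCode.1 (hG v z nz))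
      have g1 := h.table (l := [v, w, y]) (by simp [hwv.symm.ne, ny, iy.ne]) (by simp)
      have g2 := h.table (l := [v, y, z]) (by simp [ny, nz, hy.ne]) (by simp)
      have g3 := h.table (l := [v, w, z]) (by simp [hwv.symm.ne, nz, iz.ne]) (by simp)
      have g4 := h.table (l := [v, w, y, z])
        (by simp [hwv.symm.ne, nz, ny, iz.ne, iy.ne, hy.ne]) (by simp)
      simp only [Dgraph.table, List.map, iz.2, iy.2, hy.2, e2, c3] at g1 g2 g3 g4
      rcases cycle_step_codes (pairFin G w y) (pairFin G w y) ⟨iy.1, rfl⟩ (pairFin G v w)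
        (pairFin G' v w) hwv.symm (pairFin G v y) (pairFin G' v y) hvy g1 (pairFin G v z)
        (pairFin G' v z) hvz g2 g3 g4 with h5 | h5
      · refine (h.dual_right.no_par_diamond (by rwa [rev_dual_eq]) iy.1 rfl e2 c3
          (par_dual.2 hwv.symm) (par_dual.2 h5.2.2.1) (par_dual.2 h5.2.2.2) h5.1.symm
          (h5.2.1.symm.trans h5.1.symm)).elim
      · exact ⟨h5.1, h5.2.1, h5.2.2.1, h5.2.2.2⟩
  exact (key y (hM x y)).1.ne rfl

theorem HemiSix.isChainD (hG : G.ArcConnected)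
    (hP : ∀ x y, Relation.ReflTransGen (Par G G') x y)
    (hM : ∀ x y, Relation.ReflTransGen (Rev G G') x y) : G.IsChainD := by
  have hT := h.isTournament hG hP hM
  have hcode : ∀ {x y}, G.Arc x y → pairCode G x y = 1 := by
    intro x y hxy
    have hne : x ≠ y := by
      rintro rfl
      exact G.irrefl _ hxy
    rw [pairCode_eq_one]
    exact (hT x y hne).resolve_right fun h => h.2 hxy
  refine ⟨hT, fun x y z hxy hyz => ?_⟩
  have hne : x ≠ z := by
    rintro rfl
    have := hcode hxy
    rw [pairCode_eq_one] at this
    exact this.2 hyz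
  by_contra hxz
  have c2 : pairCode G x z = 2 := by
    rw [pairCode_eq_two]
    exact (hT x z hne).resolve_left fun h => hxz h.1
  rcases h.par_or_rev (Or.inl (hcode hxy)) with hs | hs
  · exact h.no_par_cycle hT hP hM (hcode hxy) c2 (hcode hyz) hs
  · exact h.dual_right.no_par_cycle hT (by rwa [par_dual_eq]) (by rwa [rev_dual_eq]) (hcode hxy)
      c2 (hcode hyz) (par_dual.2 hs)

end Connected

theorem isInterval_of_pairCode {G : Dgraph V} {I : Set V}
    (h : ∀ x ∉ I, ∃ j, ∀ y ∈ I, pairCode G x y = j) : G.IsInterval I := by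
  intro x hx
  obtain ⟨j, hj⟩ := h x hx
  by_cases hI : I.Nonempty
  · obtain ⟨y₀, hy₀⟩ := hI
    have hlt := pairCode_lt G x y₀
    rw [hj y₀ hy₀] at hlt
    interval_cases j
    · exact Or.inr (Or.inr (Or.inr fun y hy => pairCode_eq_zero.1 (hj y hy)))
    · exact Or.inl fun y hy => pairCode_eq_one.1 (hj y hy)
    · exact Or.inr (Or.inl fun y hy => pairCode_eq_two.1 (hj y hy))
    · exact Or.inr (Or.inr (Or.inl fun y hy => pairCode_eq_three.1 (hj y hy)))
  · exact Or.inl fun y hy => absurd ⟨y, hy⟩ hI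

theorem IsInterval.pairCode_eq {G : Dgraph V} {I : Set V} (h : G.IsInterval I) {x y z : V}
    (hx : x ∉ I) (hy : y ∈ I) (hz : z ∈ I) : pairCode G x y = pairCode G x z := by
  rcases h x hx with h | h | h | h
  · rw [pairCode_eq_one.2 (h y hy), pairCode_eq_one.2 (h z hz)]
  · rw [pairCode_eq_two.2 (h y hy), pairCode_eq_two.2 (h z hz)]
  · rw [pairCode_eq_three.2 (h y hy), pairCode_eq_three.2 (h z hz)]
  · rw [pairCode_eq_zero.2 (h y hy), pairCode_eq_zero.2 (h z hz)]

theorem IsChainD.exists_equiv_fin [Fintype V] {G : Dgraph V} (h : G.IsChainD) :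
    ∃ e : V ≃ Fin (Fintype.card V), ∀ x y, G.Arc x y ↔ e x < e y := by
  classical
  have hasymm : ∀ x y, G.Arc x y → ¬ G.Arc y x := fun x y hxy hyx =>
    G.irrefl x (h.2 x y x hxy hyx)
  have : IsStrictTotalOrder V G.Arc :=
    { trichotomous := fun x y hxy hyx => by
        by_contra hne
        rcases h.1 x y hne with h1 | h1
        · exact hxy h1.1
        · exact hyx h1.1
      irrefl := G.irrefl
      trans := h.2 }
  let : LinearOrder V := linearOrderOfSTO G.Arc
  exact ⟨(Fintype.orderIsoFinOfCardEq V rfl).symm.toEquiv, fun x y =>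
    (OrderIso.lt_iff_lt (Fintype.orderIsoFinOfCardEq V rfl).symm).symm⟩

theorem IsChainD.iso [Finite V] {G G' : Dgraph V} (h : G.IsChainD) (h' : G'.IsChainD) :
    Iso G G' := by
  have := Fintype.ofFinite V
  obtain ⟨e, he⟩ := h.exists_equiv_fin
  obtain ⟨e', he'⟩ := h'.exists_equiv_fin
  exact ⟨e.trans e'.symm, fun x y => by rw [he, he']; simp⟩

theorem IsChainD.dual {G : Dgraph V} (h : G.IsChainD) : G.dual.IsChainD :=
  ⟨fun x y hne => h.1 y x hne.symm, fun x y z hxy hyz => h.2 z y x hyz hxy⟩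

theorem HemiSix.isChainD_right {G G' : Dgraph V} (h : HemiSix G G') (hG : G.IsChainD) :
    G'.IsChainD := by
  have hT : G'.IsTournament := by
    intro x y hne
    have hd := hG.1 x y hne
    rw [dir_iff_pairCode] at hd ⊢
    rcases h.par_or_rev hd with h1 | h1
    · rwa [h1.2]
    · rw [h1.2]
      exact swapCode_dir hd
  have hcode : ∀ {H : Dgraph V} {x y}, H.IsTournament → H.Arc x y → pairCode H x y = 1 := by
    intro H x y hH hxy
    have hne : x ≠ y := by
      rintro rfl
      exact H.irrefl _ hxy
    rw [pairCode_eq_one]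
    exact (hH x y hne).resolve_right fun h => h.2 hxy
  refine ⟨hT, fun x y z hxy hyz => ?_⟩
  have hne : x ≠ z := by
    rintro rfl
    have := hcode hT hxy
    rw [pairCode_eq_one] at this
    exact this.2 hyz
  by_contra hxz
  have c2 : pairCode G' x z = 2 := by
    rw [pairCode_eq_two]
    exact (hT x z hne).resolve_left fun h => hxz h.1
  have c1 := hcode hT hxy
  have hs := h.symm.cycle_status (Or.inl rfl) c1 c2 (hcode hT hyz)
  have hxy0 : x ≠ y := ne_of_dirCode (Or.inl c1)
  rcases dir_iff_pairCode.1 (hG.1 x y hxy0) with e | e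
  · rw [e] at hs
    have := hcode hG.1 (hG.2 x y z (pairCode_eq_one.1 e).1 (pairCode_eq_one.1 hs.2).1)
    rw [hs.1] at this
    simp [swapCode] at this
  · rw [e] at hs
    have := hcode hG.1 (hG.2 z y x (pairCode_eq_two.1 hs.2).1 (pairCode_eq_two.1 e).1)
    rw [pairCode_swap G x z, hs.1] at this
    simp [swapCode] at this

section Assembly

variable {ι : Type*}

/-- Isomorphisms between the fibers of a map whose fibers are intervals can be glued. -/
theorem exists_equiv_of_fibers {A B : Dgraph V} (f : V → ι)
    (hunif : ∀ x y z, f y = f z → f x ≠ f y → pairCode A x y = pairCode A x z)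
    (hcross : ∀ x y, f x ≠ f y → pairCode A x y = pairCode B x y)
    (hiso : ∀ i, Iso (A.ind {y | f y = i}) (B.ind {y | f y = i})) : Iso A B := by
  choose E hE using hiso
  have aux : ∀ i x (h : f x = i), (E (f x) ⟨x, rfl⟩).1 = (E i ⟨x, h⟩).1 := by
    rintro i x rfl
    rfl
  have aux' : ∀ i x (h : f x = i), ((E (f x)).symm ⟨x, rfl⟩).1 = ((E i).symm ⟨x, h⟩).1 := by
    rintro i x rfl
    rfl
  let F : V ≃ V :=
    { toFun := fun x => (E (f x) ⟨x, rfl⟩).1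
      invFun := fun x => ((E (f x)).symm ⟨x, rfl⟩).1
      left_inv := fun x => by
        dsimp only
        rw [aux' (f x) _ (E (f x) ⟨x, rfl⟩).2]
        simp
      right_inv := fun x => by
        dsimp only
        rw [aux (f x) _ ((E (f x)).symm ⟨x, rfl⟩).2]
        simp }
  have hF : ∀ x, f (F x) = f x := fun x => (E (f x) ⟨x, rfl⟩).2
  refine ⟨F, fun x y => ?_⟩
  by_cases hxy : f x = f y
  · have h1 : F x = (E (f y) ⟨x, hxy⟩).1 := aux _ _ hxy
    have h2 : F y = (E (f y) ⟨y, rfl⟩).1 := rfl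
    rw [h1, h2]
    exact hE (f y) ⟨x, hxy⟩ ⟨y, rfl⟩
  · apply arc_iff_of_pairCode_eq
    rw [← hcross (F x) (F y) (by rwa [hF, hF]), hunif x y (F y) (hF y).symm hxy,
      pairCode_swap A (F y) x, pairCode_swap A (F y) (F x),
      hunif (F y) x (F x) (hF x).symm (by rw [hF]; exact Ne.symm hxy)]

/-- Two digraphs which agree between the fibers of a map, these fibers being intervals of the
first one inducing chains in both. -/
structure ChainFibers (f : V → ι) (A B : Dgraph V) : Prop where
  interval : ∀ x y z, f y = f z → f x ≠ f y → pairCode A x y = pairCode A x z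
  cross : ∀ x y, f x ≠ f y → pairCode A x y = pairCode B x y
  dir_left : ∀ x y, f x = f y → x ≠ y → A.Dir x y
  dir_right : ∀ x y, f x = f y → x ≠ y → B.Dir x y
  trans_left : ∀ x y z, f x = f y → f y = f z → A.Arc x y → A.Arc y z → A.Arc x z
  trans_right : ∀ x y z, f x = f y → f y = f z → B.Arc x y → B.Arc y z → B.Arc x z

theorem ChainFibers.iso {f : V → ι} {A B : Dgraph V} (h : ChainFibers f A B)
    (hfin : ∀ i, {y | f y = i}.Finite) : Iso A B := by
  refine exists_equiv_of_fibers f h.interval h.cross fun i => ?_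
  have := (hfin i).to_subtype
  refine IsChainD.iso ⟨fun x y hne => ?_, fun x y z => ?_⟩ ⟨fun x y hne => ?_, fun x y z => ?_⟩
  · exact h.dir_left x y (x.2.trans y.2.symm) (Subtype.coe_injective.ne hne)
  · exact h.trans_left x y z (x.2.trans y.2.symm) (y.2.trans z.2.symm)
  · exact h.dir_right x y (x.2.trans y.2.symm) (Subtype.coe_injective.ne hne)
  · exact h.trans_right x y z (x.2.trans y.2.symm) (y.2.trans z.2.symm)

theorem ChainFibers.comap {f : V → ι} {A B : Dgraph V} (h : ChainFibers f A B) {g : W → V}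
    (hg : Function.Injective g) : ChainFibers (f ∘ g) (comap g A) (comap g B) where
  interval x y z := h.interval (g x) (g y) (g z)
  cross x y := h.cross (g x) (g y)
  dir_left x y hxy hne := h.dir_left (g x) (g y) hxy (hg.ne hne)
  dir_right x y hxy hne := h.dir_right (g x) (g y) hxy (hg.ne hne)
  trans_left x y z := h.trans_left (g x) (g y) (g z)
  trans_right x y z := h.trans_right (g x) (g y) (g z)

end Assembly

/-- Addition of a source (`b = true`) or of a sink (`b = false`). -/
def addPt (b : Bool) (G : Dgraph W) : Dgraph (Option W) where
  Arc := fun p q =>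
    match p, q with
    | some x, some y => G.Arc x y
    | none, some _ => b = true
    | some _, none => b = false
    | none, none => False
  irrefl := by
    rintro (_ | x)
    · exact id
    · exact G.irrefl x

section AddPt

variable (b : Bool) (G G' : Dgraph W)

theorem pairCode_addPt_some (x y : W) :
    pairCode (addPt b G) (some x) (some y) = pairCode G x y := rfl

theorem pairCode_addPt_none (x : W) :
    pairCode (addPt b G) none (some x) = if b then 1 else 2 := by
  cases b
  · exact pairCode_eq_two.2 ⟨rfl, Bool.false_ne_true⟩
  · exact pairCode_eq_one.2 ⟨rfl, Bool.true_eq_false.mp⟩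

theorem par_addPt_none (x : W) : Par (addPt b G) (addPt b G') none (some x) := by
  unfold Par ParC
  rw [pairCode_addPt_none, pairCode_addPt_none]
  cases b <;> simp

variable {b G G'}

theorem HemiSix.of_addPt (h : HemiSix (addPt b G) (addPt b G')) : HemiSix G G' :=
  h.comap (g := some) (Option.some_injective W)

theorem ChainFibers.addPt {ι : Type*} {f : W → ι} (h : ChainFibers f G G') :
    ChainFibers (Option.map f) (addPt b G) (addPt b G') where
  interval := by
    rintro (_ | x) (_ | y) (_ | z) h1 h2 <;> try simp at h1 h2
    · rw [pairCode_addPt_none, pairCode_addPt_none]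
    · rfl
    · exact h.interval x y z h1 h2
  cross := by
    rintro (_ | x) (_ | y) h1 <;> try simp at h1
    · rw [pairCode_addPt_none, pairCode_addPt_none]
    · rw [pairCode_swap _ none, pairCode_swap _ none, pairCode_addPt_none, pairCode_addPt_none]
    · exact h.cross x y h1
  dir_left := by
    rintro (_ | x) (_ | y) h1 h2 <;> simp at h1 h2
    exact h.dir_left x y h1 h2
  dir_right := by
    rintro (_ | x) (_ | y) h1 h2 <;> simp at h1 h2
    exact h.dir_right x y h1 h2
  trans_left := by
    rintro (_ | x) (_ | y) (_ | z) h1 h2 <;> simp at h1 h2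
    · exact fun h _ => h
    · exact h.trans_left x y z h1 h2
  trans_right := by
    rintro (_ | x) (_ | y) (_ | z) h1 h2 <;> simp at h1 h2
    · exact fun h _ => h
    · exact h.trans_right x y z h1 h2

end AddPt

/-- The equivalence relation whose classes are the classes of reachability through reversed
pairs. -/
def revSetoid (G G' : Dgraph V) : Setoid V where
  r := Relation.ReflTransGen (Rev G G')
  iseqv := ⟨fun _ => Relation.ReflTransGen.refl,
    fun h => have : Std.Symm (Rev G G') := ⟨fun _ _ => Rev.symm⟩
      Relation.ReflTransGen.stdSymm.symm _ _ h, fun h h' => h.trans h'⟩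

theorem mk_eq_mk_iff {G G' : Dgraph V} {x y : V} :
    (Quotient.mk (revSetoid G G') x = Quotient.mk (revSetoid G G') y) ↔ y ∈ revClass G G' x :=
  Quotient.eq (r := revSetoid G G')

theorem fiber_mk_eq {G G' : Dgraph V} (x : V) :
    {y | Quotient.mk (revSetoid G G') y = Quotient.mk (revSetoid G G') x} = revClass G G' x := by
  ext y
  rw [← mk_eq_mk_iff]
  exact eq_comm

theorem revClass_ne_univ {G G' : Dgraph V} {c : V} (hc : revClass G G' c ≠ Set.univ) (x : V) :
    revClass G G' x ≠ Set.univ := by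
  intro hx
  apply hc
  refine Set.eq_univ_of_forall fun y => ?_
  have h1 : c ∈ revClass G G' x := hx ▸ Set.mem_univ c
  have h2 : y ∈ revClass G G' x := hx ▸ Set.mem_univ y
  rw [← mk_eq_mk_iff] at *
  exact h1.symm.trans h2

/-- Every interval inducing a chain is finite. -/
def NoInfChain (G : Dgraph V) : Prop :=
  ∀ I : Set V, G.IsInterval I → (G.ind I).IsChainD → I.Finite

theorem HemiSix.iso_or_selfHemi {b : Bool} {G G' : Dgraph W}
    (h : HemiSix (addPt b G) (addPt b G'))
    (hM : ∀ x y, Relation.ReflTransGen (Rev G G') x y) (hfin : NoInfChain G) :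
    Iso G G' ∨ (Iso G.dual G' ∧ HemiSix (addPt b G) (addPt b G.dual)) := by
  have hW := h.of_addPt
  have hG : G.ArcConnected := fun x y =>
    Relation.ReflTransGen.mono (fun _ _ h => dir_iff_pairCode.2 h.1) _ _ (hM x y)
  by_cases hP : ∀ x y, Relation.ReflTransGen (Par G G') x y
  · have hc := hW.isChainD hG hP hM
    have : (Set.univ : Set W).Finite := by
      refine hfin _ (fun x hx => absurd (Set.mem_univ x) hx) ⟨fun x y hne => ?_, fun x y z => ?_⟩
      · exact hc.1 x y (Subtype.coe_injective.ne hne)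
      · exact hc.2 x y z
    have := Set.finite_univ_iff.1 this
    exact Or.inl (hc.iso (hW.isChainD_right hc))
  refine Or.inr ?_
  obtain ⟨c, hc⟩ : ∃ c, revClass G G'.dual c ≠ Set.univ := by
    by_contra! hcon
    refine hP fun x y => ?_
    have : y ∈ revClass G G'.dual x := hcon x ▸ Set.mem_univ y
    rwa [revClass, rev_dual_eq] at this
  have hcl := revClass_ne_univ hc
  have hunif := fun x => hW.dual_right.revClass_interval hG (hcl x)
  have hchain : ∀ c, (G.ind (revClass G G'.dual c)).IsChainD := by
    intro c
    obtain ⟨⟨z, k, hz⟩, -⟩ := hunif c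
    have hT : ∀ x y, x ∈ revClass G G'.dual c → y ∈ revClass G G'.dual c → x ≠ y →
        G.Dir x y := by
      intro x y hx hy hne
      by_contra hcon
      have hn : Ntl G G' x y := by
        rcases hW.cases x y with h1 | h1 | h1
        · exact absurd (dir_iff_pairCode.2 h1.1) hcon
        · exact absurd (dir_iff_pairCode.2 h1.1) hcon
        · exact h1
      exact h.peak_false (par_addPt_none b G G' z) (par_addPt_none b G G' x)
        (par_addPt_none b G G' y) (pairCode_addPt_none b G z) (pairCode_addPt_none b G x)
        (pairCode_addPt_none b G y) (par_dual.1 (hz x hx).1) (par_dual.1 (hz y hy).1)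
        ((hz x hx).2.trans (hz y hy).2.symm) (fun he => hne (Option.some_injective _ he)) hn
    refine ⟨fun x y hne => hT x y x.2 y.2 (Subtype.coe_injective.ne hne), ?_⟩
    rintro ⟨x, hx⟩ ⟨y, hy⟩ ⟨w, hw⟩ (hxy : G.Arc x y) (hyw : G.Arc y w)
    have hcode : ∀ x y, x ∈ revClass G G'.dual c → y ∈ revClass G G'.dual c → G.Arc x y →
        pairCode G x y = 1 := by
      intro x y hx hy hxy
      rw [pairCode_eq_one]
      refine (hT x y hx hy ?_).resolve_right fun h => h.2 hxy
      rintro rfl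
      exact G.irrefl _ hxy
    have e1 := hcode x y hx hy hxy
    have e2 := hcode y w hy hw hyw
    have hne : x ≠ w := by
      rintro rfl
      exact (pairCode_eq_one.1 e1).2 hyw
    by_contra hxw
    have e3 : pairCode G x w = 2 := by
      rw [pairCode_eq_two]
      exact (hT x w hx hw hne).resolve_left fun h => hxw h.1
    exact h.diamond_false (c := 1) (par_addPt_none b G G' z) (par_addPt_none b G G' x)
      (par_addPt_none b G G' y) (par_addPt_none b G G' w) (pairCode_addPt_none b G z)
      (pairCode_addPt_none b G x) (pairCode_addPt_none b G y) (pairCode_addPt_none b G w)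
      (par_dual.1 (hz x hx).1) (par_dual.1 (hz y hy).1) (par_dual.1 (hz w hw).1)
      ((hz y hy).2.trans (hz x hx).2.symm) ((hz w hw).2.trans (hz x hx).2.symm) (Or.inl rfl)
      e1 e3 e2
  have hchain' : ∀ c, (G'.ind (revClass G G'.dual c)).IsChainD := fun c =>
    (hW.comap (g := (Subtype.val : revClass G G'.dual c → W))
      Subtype.val_injective).isChainD_right (hchain c)
  let f : W → Quotient (revSetoid G G'.dual) := Quotient.mk _
  have hf : ∀ {x y}, f x = f y ↔ y ∈ revClass G G'.dual x := mk_eq_mk_iff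
  have hswap : ∀ {H : Dgraph W} {x y z : W},
      pairCode H.dual x y = pairCode H.dual x z → pairCode H x y = pairCode H x z := by
    intro H x y z he
    rw [pairCode_dual, pairCode_dual] at he
    rw [← swapCode_swapCode (pairCode H x y), he, swapCode_swapCode]
  have hCF : ChainFibers f G' G.dual := by
    refine ⟨fun x y z hyz hxy => ?_, fun x y hxy => ?_, fun x y hxy hne => ?_,
      fun x y hxy hne => ?_, fun x y z hxy hyz => ?_, fun x y z hxy hyz => ?_⟩
    · obtain ⟨j, hj⟩ := (hunif y).2 x fun hx => hxy (hf.2 hx).symm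
      exact hswap ((hj y Relation.ReflTransGen.refl).2.trans (hj z (hf.1 hyz)).2.symm)
    · rw [pairCode_dual]
      rcases hW.cases x y with h1 | h1 | h1
      · exact absurd (hf.2 (Relation.ReflTransGen.single (rev_dual.2 h1))) hxy
      · exact h1.2
      · rw [h1.2]
        rcases h1.1 with e | e <;> rw [e] <;> rfl
    · exact (hchain' x).1 ⟨x, Relation.ReflTransGen.refl⟩ ⟨y, hf.1 hxy⟩
        fun he => hne (congrArg Subtype.val he)
    · exact (hchain x).1 ⟨y, hf.1 hxy⟩ ⟨x, Relation.ReflTransGen.refl⟩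
        fun he => hne (congrArg Subtype.val he).symm
    · exact (hchain' x).2 ⟨x, Relation.ReflTransGen.refl⟩ ⟨y, hf.1 hxy⟩ ⟨z, hf.1 (hxy.trans hyz)⟩
    · exact fun h1 h2 => (hchain x).2 ⟨z, hf.1 (hxy.trans hyz)⟩ ⟨y, hf.1 hxy⟩
        ⟨x, Relation.ReflTransGen.refl⟩ h2 h1
  refine ⟨(hCF.iso ?_).symm, ?_⟩
  · intro i
    induction i using Quotient.inductionOn with
    | h x =>
      have := fiber_mk_eq (G := G) (G' := G'.dual) x
      rw [show {y | f y = Quotient.mk _ x} = revClass G G'.dual x from this]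
      exact hfin _ (isInterval_of_pairCode fun y hy => ((hunif x).2 y hy).imp
        fun j hj z hz => (hj z hz).1) (hchain x)
  · intro n hn g hg
    exact (h n hn g hg).trans_iso (((hCF.addPt (b := b)).comap hg).iso fun i => Set.toFinite _)

/-- Hemimorphy of a digraph and of its dual, given by a table, after addition of a source or a
sink. -/
def selfHemiTable (k n : ℕ) (T : List (List ℕ)) : Bool :=
  hemiTable (n + 1) (List.replicate n k :: T) (List.replicate n k :: T.map (List.map swapCode))

theorem table_dual (G : Dgraph V) (l : List V) :
    table G.dual l = (table G l).map (List.map swapCode) := by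
  induction l with
  | nil => rfl
  | cons x l ih => simp [table, ih, pairCode_dual]

theorem table_comap (f : W → V) (G : Dgraph V) (l : List W) :
    table G (l.map f) = table (comap f G) l := by
  induction l with
  | nil => rfl
  | cons x l ih =>
    simp only [List.map_cons, table, ih, List.map_map]
    rfl

theorem HemiSix.selfTable {b : Bool} {G : Dgraph W} (h : HemiSix (addPt b G) (addPt b G.dual)) :
    ∃ k : Fin 4, ((k : ℕ) = 1 ∨ (k : ℕ) = 2) ∧ ∀ l : List W, l.Nodup → l.length ≤ 5 →
      selfHemiTable k l.length (Dgraph.table G l) = true := by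
  refine ⟨if b then 1 else 2, by cases b <;> simp, fun l hl hlen => ?_⟩
  have := h.table (l := none :: l.map some)
    (by simp [hl.map (Option.some_injective W)]) (by simp; omega)
  rw [Dgraph.table, Dgraph.table, table_comap, table_comap] at this
  have hrow : ∀ H : Dgraph W, (l.map some).map (pairCode (addPt b H) none) =
      List.replicate l.length ((if b then 1 else 2 : Fin 4) : ℕ) := by
    intro H
    rw [List.map_map, List.eq_replicate_iff]
    refine ⟨by simp, fun c hc => ?_⟩
    obtain ⟨x, -, rfl⟩ := List.mem_map.1 hc
    simp only [Function.comp_apply, pairCode_addPt_none]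
    cases b <;> rfl
  rw [hrow, hrow, List.length_cons, List.length_map] at this
  unfold selfHemiTable
  rw [← table_dual]
  exact this

section Tables

set_option synthInstance.maxHeartbeats 400000
set_option synthInstance.maxSize 2000
set_option maxRecDepth 4000

/-- Codes of a neutral pair. -/
abbrev NC (a : ℕ) : Prop := a = 0 ∨ a = 3

/-- Codes of a directed pair. -/
abbrev DC (a : ℕ) : Prop := a = 1 ∨ a = 2

theorem self_peak_codes : ∀ k : Fin 4, DC k → ∀ m : Fin 4, DC m → ∀ n : Fin 4, NC n →
    selfHemiTable k 3 [[m, m], [n], []] = false := by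
  decide +kernel

theorem self_flag_codes : ∀ k : Fin 4, DC k → ∀ m : Fin 4, DC m →
    selfHemiTable k 3 [[3, 0], [m], []] = false := by
  decide +kernel

theorem self_diamond_codes : ∀ k : Fin 4, DC k → ∀ m : Fin 4, DC m → ∀ c : Fin 4, DC c →
    selfHemiTable k 4 [[m, m, m], [c, swapCode c], [c], []] = false := by
  decide +kernel

/-- The list `v, p, q, r`. -/
theorem self_pendant_codes : ∀ k : Fin 4, DC k → ∀ m : Fin 4, DC m → ∀ n : Fin 4, NC n →
    ∀ n' : Fin 4, NC n' → ∀ a : Fin 4, DC a → ∀ b : Fin 4, DC b → ∀ c : Fin 4, DC c →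
    selfHemiTable k 3 [[m, n], [a], []] = true →
    selfHemiTable k 3 [[m, n'], [b], []] = true →
    selfHemiTable k 3 [[n, n'], [c], []] = true →
    selfHemiTable k 3 [[a, b], [c], []] = true →
    selfHemiTable k 4 [[m, n, n'], [a, b], [c], []] = false := by
  decide +kernel

/-- The list `a, a', s₁, s₂, t`. -/
theorem self_square_codes : ∀ k : Fin 4, DC k → ∀ n : Fin 4, NC n → ∀ p q : Fin 4,
    ¬ (NC p ∧ NC q) →
    selfHemiTable k 4 [[n, 1, 2], [2, 1], [swapCode p], []] = true →
    selfHemiTable k 4 [[n, 1, 2], [2, 1], [swapCode q], []] = true →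
    selfHemiTable k 4 [[1, 1, 2], [1, swapCode p], [swapCode q], []] = true →
    selfHemiTable k 4 [[2, 2, 1], [1, swapCode p], [swapCode q], []] = true →
    selfHemiTable k 5 [[n, 1, 1, 2], [2, 2, 1], [1, swapCode p], [swapCode q], []] = true →
    ((p : ℕ) = 1 ∨ NC p) ∧ ((q : ℕ) = 2 ∨ NC q) := by
  decide +kernel

/-- The list `a', s₁, s₂, s₃, t`. -/
theorem self_triple_codes : ∀ k : Fin 4, DC k → ∀ n : Fin 4, NC n →
    selfHemiTable k 5 [[2, 2, 2, 1], [1, 1, 2], [1, n], [1], []] = false := by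
  decide +kernel

/-- The list `a, a', s₁, t₁, s₂`. -/
theorem self_hexagon_codes : ∀ k : Fin 4, DC k → ∀ n : Fin 4, NC n → ∀ n' : Fin 4, NC n' →
    selfHemiTable k 5 [[n, 1, 2, 1], [2, 1, 2], [n', 1], [2], []] = true → (n : ℕ) = n' := by
  decide +kernel

end Tables

theorem Dir.symm {G : Dgraph V} {x y : V} (h : G.Dir x y) : G.Dir y x := Or.symm h

theorem Dir.ne {G : Dgraph V} {x y : V} (h : G.Dir x y) : x ≠ y :=
  ne_of_dirCode (dir_iff_pairCode.1 h)

theorem ntlCode_of_not_dir {G : Dgraph V} {x y : V} (h : ¬ G.Dir x y) : NC (pairCode G x y) := by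
  rw [dir_iff_pairCode] at h
  have := pairCode_lt G x y
  unfold NC
  omega

theorem not_dir_iff {G : Dgraph V} {x y : V} : ¬ G.Dir x y ↔ NC (pairCode G x y) := by
  refine ⟨ntlCode_of_not_dir, fun h h' => ?_⟩
  rw [dir_iff_pairCode] at h'
  unfold NC at h
  omega

theorem val_pairFin (G : Dgraph V) (x y : V) : (pairFin G x y : ℕ) = pairCode G x y := rfl

/-- Local properties of the digraphs which cannot be distinguished from their dual on few vertices
after addition of a source or a sink. -/
structure LocalSelf (G : Dgraph W) : Prop where
  peak : ∀ {w x y : W}, G.Dir w x → pairCode G w y = pairCode G w x → x ≠ y → G.Dir x y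
  flag : ∀ {x y z : W}, x ≠ y → x ≠ z → ¬ G.Dir x y → ¬ G.Dir x z → G.Dir y z →
    pairCode G x y = pairCode G x z
  diamond : ∀ {w x y z : W}, G.Dir w x → pairCode G w y = pairCode G w x →
    pairCode G w z = pairCode G w x → G.Dir x y → pairCode G x z = swapCode (pairCode G x y) →
    pairCode G y z ≠ pairCode G x y
  pendant : ∀ {v p q r : W}, G.Dir p q → G.Dir p r → G.Dir q r → G.Dir v p → ¬ G.Dir v q →
    G.Dir v r
  square : ∀ {a a' x y t : W}, a ≠ a' → ¬ G.Dir a a' → pairCode G a x = 1 → pairCode G a' x = 2 →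
    pairCode G a y = 1 → pairCode G a' y = 2 → pairCode G a t = 2 → pairCode G a' t = 1 →
    pairCode G x y = 1 → (G.Dir t x ∨ G.Dir t y) →
    (pairCode G t x = 1 ∨ ¬ G.Dir t x) ∧ (pairCode G t y = 2 ∨ ¬ G.Dir t y)
  triple : ∀ {a' x y z t : W}, pairCode G a' x = 2 → pairCode G a' y = 2 → pairCode G a' z = 2 →
    pairCode G a' t = 1 → pairCode G x y = 1 → pairCode G x z = 1 → pairCode G y z = 1 →
    pairCode G x t = 2 → t ≠ y → ¬ G.Dir y t → pairCode G z t ≠ 1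
  hexagon : ∀ {a a' x t y : W}, a ≠ a' → x ≠ t → ¬ G.Dir a a' → ¬ G.Dir x t →
    pairCode G a x = 1 → pairCode G a' x = 2 → pairCode G a y = 1 → pairCode G a' y = 2 →
    pairCode G a t = 2 → pairCode G a' t = 1 → pairCode G x y = 1 → pairCode G t y = 2 →
    pairCode G a a' = pairCode G x t

theorem HemiSix.localSelf {b : Bool} {G : Dgraph W} (h : HemiSix (addPt b G) (addPt b G.dual)) :
    LocalSelf G := by
  obtain ⟨k, hk, hT⟩ := h.selfTable
  have h3 : ∀ x y z, x ≠ y → x ≠ z → y ≠ z →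
      selfHemiTable k 3 [[pairCode G x y, pairCode G x z], [pairCode G y z], []] = true :=
    fun x y z h1 h2 h3 => hT [x, y, z] (by simp [*]) (by simp)
  have h4 : ∀ x y z t, x ≠ y → x ≠ z → x ≠ t → y ≠ z → y ≠ t → z ≠ t →
      selfHemiTable k 4 [[pairCode G x y, pairCode G x z, pairCode G x t],
        [pairCode G y z, pairCode G y t], [pairCode G z t], []] = true :=
    fun x y z t h1 h2 h3 h4 h5 h6 => hT [x, y, z, t] (by simp [*]) (by simp)
  have h5 : ∀ x y z t s, x ≠ y → x ≠ z → x ≠ t → x ≠ s → y ≠ z → y ≠ t → y ≠ s → z ≠ t →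
      z ≠ s → t ≠ s →
      selfHemiTable k 5 [[pairCode G x y, pairCode G x z, pairCode G x t, pairCode G x s],
        [pairCode G y z, pairCode G y t, pairCode G y s], [pairCode G z t, pairCode G z s],
        [pairCode G t s], []] = true :=
    fun x y z t s h1 h2 h3 h4 h5 h6 h7 h8 h9 h10 => hT [x, y, z, t, s] (by simp [*]) (by simp)
  have hD : ∀ {x y}, G.Dir x y → DC (pairFin G x y : ℕ) := fun h => dir_iff_pairCode.1 h
  have hN : ∀ {x y}, ¬ G.Dir x y → NC (pairFin G x y : ℕ) := fun h => ntlCode_of_not_dir h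
  have ne1 : ∀ {x y}, pairCode G x y = 1 → x ≠ y := fun h => ne_of_dirCode (Or.inl h)
  have ne2 : ∀ {x y}, pairCode G x y = 2 → x ≠ y := fun h => ne_of_dirCode (Or.inr h)
  refine ⟨?_, ?_, ?_, ?_, ?_, ?_, ?_⟩
  · intro w x y hwx he hxy
    by_contra hn
    have hwy : G.Dir w y := by rwa [dir_iff_pairCode, he, ← dir_iff_pairCode]
    have := h3 w x y hwx.ne hwy.ne hxy
    rw [he] at this
    exact Bool.false_ne_true
      ((self_peak_codes k hk (pairFin G w x) (hD hwx) (pairFin G x y) (hN hn)).symm.trans this)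
  · intro x y z hxy hxz hny hnz hyz
    have h1 := ntlCode_of_not_dir hny
    have h2 := ntlCode_of_not_dir hnz
    have t1 := h3 x y z hxy hxz hyz.ne
    have t2 := h3 x z y hxz hxy hyz.ne.symm
    rw [← val_pairFin G z y] at t2
    rw [← val_pairFin G y z] at t1
    rcases h1 with e1 | e1 <;> rcases h2 with e2 | e2
    · rw [e1, e2]
    · rw [e1, e2, self_flag_codes k hk (pairFin G z y) (hD hyz.symm)] at t2
      exact absurd t2 Bool.false_ne_true
    · rw [e1, e2, self_flag_codes k hk (pairFin G y z) (hD hyz)] at t1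
      exact absurd t1 Bool.false_ne_true
    · rw [e1, e2]
  · intro w x y z hwx hwy hwz hxy hxz hyz
    have dxz : G.Dir x z := by
      rw [dir_iff_pairCode, hxz]
      exact swapCode_dir (dir_iff_pairCode.1 hxy)
    have := h4 w x y z hwx.ne (ne_of_dirCode (hwy ▸ dir_iff_pairCode.1 hwx))
      (ne_of_dirCode (hwz ▸ dir_iff_pairCode.1 hwx)) hxy.ne dxz.ne
      (ne_of_dirCode (hyz ▸ dir_iff_pairCode.1 hxy))
    rw [hwy, hwz, hxz, hyz] at this
    simp only [← val_pairFin] at this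
    exact Bool.false_ne_true
      ((self_diamond_codes k hk (pairFin G w x) (hD hwx) (pairFin G x y) (hD hxy)).symm.trans this)
  · intro v p q r hpq hpr hqr hvp hvq
    by_contra hvr
    have nvq : v ≠ q := by
      rintro rfl
      exact hvr hqr
    have nvr : v ≠ r := by
      rintro rfl
      exact hvq hqr.symm
    have t0 := h4 v p q r hvp.ne nvq nvr hpq.ne hpr.ne hqr.ne
    have t1 := h3 v p q hvp.ne nvq hpq.ne
    have t2 := h3 v p r hvp.ne nvr hpr.ne
    have t3 := h3 v q r nvq nvr hqr.ne
    have t4 := h3 p q r hpq.ne hpr.ne hqr.ne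
    simp only [← val_pairFin] at t0 t1 t2 t3 t4
    have := self_pendant_codes k hk (pairFin G v p) (hD hvp) (pairFin G v q) (hN hvq)
      (pairFin G v r) (hN hvr) (pairFin G p q) (hD hpq) (pairFin G p r) (hD hpr)
      (pairFin G q r) (hD hqr) t1 t2 t3 t4
    rw [t0] at this
    exact Bool.false_ne_true this.symm
  · intro a a' x y t haa hn ax ax' ay ay' at' at'' xy hd
    have htx : t ≠ x := by
      rintro rfl
      omega
    have hty : t ≠ y := by
      rintro rfl
      omega
    have q1 := h4 a a' x t haa (ne1 ax) (ne2 at') (ne2 ax') (ne1 at'') htx.symm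
    have q2 := h4 a a' y t haa (ne1 ay) (ne2 at') (ne2 ay') (ne1 at'') hty.symm
    have q3 := h4 a x y t (ne1 ax) (ne1 ay) (ne2 at') (ne1 xy) htx.symm hty.symm
    have q4 := h4 a' x y t (ne2 ax') (ne2 ay') (ne1 at'') (ne1 xy) htx.symm hty.symm
    have q5 := h5 a a' x y t haa (ne1 ax) (ne1 ay) (ne2 at') (ne2 ax') (ne2 ay') (ne1 at'')
      (ne1 xy) htx.symm hty.symm
    rw [ax, ax', at', at'', pairCode_swap G t x] at q1
    rw [ay, ay', at', at'', pairCode_swap G t y] at q2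
    rw [ax, ay, at', xy, pairCode_swap G t x, pairCode_swap G t y] at q3
    rw [ax', ay', at'', xy, pairCode_swap G t x, pairCode_swap G t y] at q4
    rw [ax, ax', ay, ay', at', at'', xy, pairCode_swap G t x, pairCode_swap G t y] at q5
    simp only [← val_pairFin] at q1 q2 q3 q4 q5
    rw [not_dir_iff, not_dir_iff]
    refine self_square_codes k hk (pairFin G a a') (hN hn) (pairFin G t x) (pairFin G t y) ?_
      q1 q2 q3 q4 q5
    rintro ⟨e1, e2⟩
    rcases hd with hd | hd
    · exact not_dir_iff.2 e1 hd
    · exact not_dir_iff.2 e2 hd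
  · intro a' x y z t ax ay az at' xy xz yz xt hty hn zt
    have := h5 a' x y z t (ne2 ax) (ne2 ay) (ne2 az) (ne1 at') (ne1 xy) (ne1 xz) (ne2 xt)
      (ne1 yz) hty.symm (ne1 zt)
    rw [ax, ay, az, at', xy, xz, yz, xt, zt] at this
    simp only [← val_pairFin] at this
    exact Bool.false_ne_true
      ((self_triple_codes k hk (pairFin G y t) (hN hn)).symm.trans this)
  · intro a a' x t y haa hxt hn hn' ax ax' ay ay' at' at'' xy ty
    have := h5 a a' x t y haa (ne1 ax) (ne2 at') (ne1 ay) (ne2 ax') (ne1 at'') (ne2 ay')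
      hxt (ne1 xy) (ne2 ty)
    rw [ax, ax', ay, ay', at', at'', xy, ty] at this
    simp only [← val_pairFin] at this
    exact self_hexagon_codes k hk (pairFin G a a') (hN hn) (pairFin G x t) (hN hn') this

section Triangle

variable {G : Dgraph W} (L : LocalSelf G) (hG : G.ArcConnected)
include L

theorem LocalSelf.dir_triangle (hG : G.ArcConnected) {p q r : W} (hpq : G.Dir p q)
    (hpr : G.Dir p r) (hqr : G.Dir q r) (v : W) : G.Dir v p ∨ G.Dir v q ∨ G.Dir v r := by
  have key : ∀ {p q r v w : W}, G.Dir p q → G.Dir p r → G.Dir q r → G.Dir v p → G.Dir w v →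
      ¬ G.Dir w p → ¬ G.Dir w q → G.Dir w r := by
    intro p q r v w hpq hpr hqr hvp hwv hwp hwq
    by_contra hwr
    by_cases hvq : G.Dir v q
    · exact hwq (L.pendant hvp hvq hpq hwv hwp)
    · exact hwr (L.pendant hvp (L.pendant hpq hpr hqr hvp hvq) hpr hwv hwp)
  induction hG p v with
  | refl => exact Or.inr (Or.inl hpq)
  | tail _ hvw ih =>
    rename_i v w _
    by_contra! hcon
    obtain ⟨h1, h2, h3⟩ := hcon
    rcases ih with hv | hv | hv
    · exact h3 (key hpq hpr hqr hv hvw.symm h1 h2)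
    · exact h3 (key hpq.symm hqr hpr hv hvw.symm h2 h1)
    · exact h2 (key hpr.symm hqr.symm hpq hv hvw.symm h3 h1)

theorem LocalSelf.dir_triangle_two (hG : G.ArcConnected) {p q r : W} (hpq : G.Dir p q)
    (hpr : G.Dir p r) (hqr : G.Dir q r) (v : W) (hv : ¬ G.Dir v p) : G.Dir v q ∧ G.Dir v r := by
  rcases L.dir_triangle hG hpq hpr hqr v with h | h | h
  · exact absurd h hv
  · exact ⟨h, L.pendant hpq.symm hqr hpr h hv⟩
  · exact ⟨L.pendant hpr.symm hqr.symm hpq h hv, h⟩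

theorem LocalSelf.not_triangle (hG : G.ArcConnected) {x y z p q r : W} (hxy : ¬ G.Dir x y)
    (hxz : ¬ G.Dir x z) (hyz : G.Dir y z) (hpq : G.Dir p q) (hpr : G.Dir p r) : ¬ G.Dir q r := by
  intro hqr
  have no : ∀ u, G.Dir y u → ¬ G.Dir z u := fun u hy hz =>
    hxz (L.dir_triangle_two hG hyz hy hz x hxy).1
  by_cases h1 : G.Dir y p
  · have h2 := L.dir_triangle_two hG hpq hpr hqr z (no p h1)
    by_cases h3 : G.Dir y q
    · exact no q h3 h2.1
    · exact no r (L.dir_triangle_two hG hpq.symm hqr hpr y h3).2 h2.2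
  · have h2 := L.dir_triangle_two hG hpq hpr hqr y h1
    have h3 := L.dir_triangle_two hG hpq.symm hqr hpr z (no q h2.1)
    exact no r h2.2 h3.2

theorem LocalSelf.exists_neutral_dir (hG : G.ArcConnected) {x y z : W} (hxy : x ≠ y)
    (hxz : x ≠ z) (hyz : y ≠ z) (nxy : ¬ G.Dir x y) (nxz : ¬ G.Dir x z) :
    ∃ x y z, ¬ G.Dir x y ∧ ¬ G.Dir x z ∧ G.Dir y z := by
  by_contra! hcon
  have nyz : ¬ G.Dir y z := hcon x y z nxy nxz
  have hw : ∃ w, G.Dir x w := by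
    rcases Relation.ReflTransGen.cases_head (hG x y) with h | ⟨w, h, -⟩
    · exact absurd h hxy
    · exact ⟨w, h⟩
  obtain ⟨w, hw⟩ := hw
  have hy : G.Dir y w := by
    by_contra h
    exact hcon y x w (fun h' => nxy h'.symm) h hw
  have hz : G.Dir z w := by
    by_contra h
    exact hcon z x w (fun h' => nxz h'.symm) h hw
  have cx := dir_iff_pairCode.1 hw.symm
  have cy := dir_iff_pairCode.1 hy.symm
  have cz := dir_iff_pairCode.1 hz.symm
  by_cases h1 : pairCode G w y = pairCode G w x
  · exact nxy (L.peak hw.symm h1 hxy)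
  by_cases h2 : pairCode G w z = pairCode G w x
  · exact nxz (L.peak hw.symm h2 hxz)
  · exact nyz (L.peak hy.symm (by omega) hyz)

end Triangle

/-- Arc-connected digraphs without flags whose vertices have at most one strict out-neighbour and
at most one strict in-neighbour. -/
structure Threadlike (G : Dgraph W) : Prop where
  conn : G.ArcConnected
  out_unique : ∀ {x y z : W}, pairCode G x y = 1 → pairCode G x z = 1 → y = z
  in_unique : ∀ {x y z : W}, pairCode G y x = 1 → pairCode G z x = 1 → y = z
  flag : ∀ {x y z : W}, x ≠ y → x ≠ z → ¬ G.Dir x y → ¬ G.Dir x z → G.Dir y z →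
    pairCode G x y = pairCode G x z

theorem LocalSelf.threadlike {G : Dgraph W} (L : LocalSelf G) (hG : G.ArcConnected) {x y z : W}
    (hxy : ¬ G.Dir x y) (hxz : ¬ G.Dir x z) (hyz : G.Dir y z) : Threadlike G := by
  have key : ∀ {x y z : W}, G.Dir x y → pairCode G x z = pairCode G x y → y = z := by
    intro u v w h1 h2
    by_contra hne
    have h3 : G.Dir u w := by rwa [dir_iff_pairCode, h2, ← dir_iff_pairCode]
    exact L.not_triangle hG hxy hxz hyz h1 h3 (L.peak h1 h2 hne)
  refine ⟨hG, fun {x y z} h1 h2 => ?_, fun {x y z} h1 h2 => ?_, L.flag⟩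
  · exact key (dir_iff_pairCode.2 (Or.inl h1)) (h2.trans h1.symm)
  · refine key (x := x) (dir_iff_pairCode.2 (Or.inl h1)).symm ?_
    rw [pairCode_swap G y x, pairCode_swap G z x, h1, h2]

namespace Threadlike

variable {G : Dgraph W} (T : Threadlike G)
include T

theorem dual : Threadlike G.dual where
  conn x y := Relation.ReflTransGen.mono (fun _ _ h => h.symm) _ _ (T.conn x y)
  out_unique := T.in_unique
  in_unique := T.out_unique
  flag := fun {x y z} hxy hxz nxy nxz hyz => by
    rw [pairCode_dual, pairCode_dual, T.flag hxy hxz (fun h => nxy h.symm) (fun h => nxz h.symm)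
      hyz.symm]

theorem exists_rank {v : W} (hv : ∀ x, pairCode G x v ≠ 1) :
    ∃ idx : W → ℕ, Function.Injective idx ∧
      (∀ x y, pairCode G x y = 1 ↔ idx x + 1 = idx y) ∧ ∀ y m, idx y = m + 1 → ∃ x, idx x = m := by
  classical
  let s : W → W := fun x => if h : ∃ y, pairCode G x y = 1 then h.choose else x
  have hs : ∀ x, s x ≠ x → pairCode G x (s x) = 1 := by
    intro x hx
    by_cases h : ∃ y, pairCode G x y = 1
    · simp only [s, dif_pos h]
      exact h.choose_spec
    · simp only [s, dif_neg h] at hx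
      exact absurd rfl hx
  have hs' : ∀ x y, pairCode G x y = 1 → s x = y := by
    intro x y h
    have h' : ∃ y, pairCode G x y = 1 := ⟨y, h⟩
    simp only [s, dif_pos h']
    exact T.out_unique h'.choose_spec h
  have hpred : ∀ n y, pairCode G y (s^[n] v) = 1 → ∃ m, s^[m] v = y := by
    intro n
    induction n with
    | zero => exact fun y h => absurd h (hv y)
    | succ n ih =>
      intro y h
      rw [Function.iterate_succ_apply'] at h
      by_cases he : s (s^[n] v) = s^[n] v
      · exact ih y (he ▸ h)
      · exact ⟨n, T.in_unique (hs _ he) h⟩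
  have hsurj : ∀ x, ∃ n, s^[n] v = x := by
    intro x
    induction T.conn v x with
    | refl => exact ⟨0, rfl⟩
    | tail _ h ih =>
      obtain ⟨n, rfl⟩ := ih
      rcases dir_iff_pairCode.1 h with h | h
      · exact ⟨n + 1, by rw [Function.iterate_succ_apply', hs' _ _ h]⟩
      · exact hpred n _ (by rw [pairCode_swap, h]; rfl)
  let idx : W → ℕ := fun x => Nat.find (hsurj x)
  have hidx : ∀ x, s^[idx x] v = x := fun x => Nat.find_spec (hsurj x)
  have hmin : ∀ x n, s^[n] v = x → idx x ≤ n := fun x n h => Nat.find_min' (hsurj x) h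
  have hlast : ∀ y m, idx y = m + 1 → pairCode G (s^[m] v) y = 1 := by
    intro y m h
    have h1 := hidx y
    rw [h, Function.iterate_succ_apply'] at h1
    have h2 : s (s^[m] v) ≠ s^[m] v := by
      intro h2
      have := hmin y m (h2.symm.trans h1)
      omega
    rw [← h1]
    exact hs _ h2
  have hto : ∀ x y, pairCode G x y = 1 ↔ idx x + 1 = idx y := by
    intro x y
    constructor
    · intro h
      have h1 : idx y ≤ idx x + 1 := hmin y _ (by
        rw [Function.iterate_succ_apply', hidx, hs' x y h])
      cases hy : idx y with
      | zero =>
        have := hidx y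
        rw [hy] at this
        rw [show y = v from this.symm] at h
        exact absurd h (hv x)
      | succ m =>
        have := hmin x m (T.in_unique (hlast y m hy) h)
        omega
    · intro h
      have h1 := hlast y _ h.symm
      rwa [hidx] at h1
  refine ⟨idx, fun x y h => ?_, hto, fun y m h => ⟨s^[m] v, ?_⟩⟩
  · rw [← hidx x, h, hidx]
  · have := (hto _ _).1 (hlast y m h)
    omega

theorem exists_eq_comap {v : W} (hv : ∀ x, pairCode G x v ≠ 1) :
    ∃ (idx : W → ℕ) (full : Bool), Function.Injective idx ∧
      (∀ x y, G.Arc x y ↔ (consecNat full).Arc (idx x) (idx y)) ∧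
      ∀ y m, m ≤ idx y → ∃ x, idx x = m := by
  obtain ⟨idx, hinj, hto, hdown⟩ := T.exists_rank hv
  have hD : ∀ x y, G.Dir x y ↔ idx x + 1 = idx y ∨ idx y + 1 = idx x := by
    intro x y
    rw [dir_iff_pairCode, hto, ← hto y x, pairCode_swap G x y]
    refine or_congr_right ⟨fun h => by rw [h]; rfl, fun h => ?_⟩
    rw [← swapCode_swapCode (pairCode G x y), h]
    rfl
  have hne : ∀ {x y}, idx x ≠ idx y → x ≠ y := fun h h' => h (congrArg idx h')
  have hneutral : ∀ n x y x' y', idx x + idx y + idx x' + idx y' = n → idx x + 2 ≤ idx y →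
      idx x' + 2 ≤ idx y' → pairCode G x y = pairCode G x' y' := by
    have left : ∀ x y, idx x + 2 ≤ idx y → ∀ m, idx x = m + 1 →
        ∃ x', idx x' = m ∧ pairCode G x y = pairCode G x' y := by
      intro x y h m hm
      obtain ⟨x', hx'⟩ := hdown x m hm
      refine ⟨x', hx', ?_⟩
      rw [pairCode_swap G y x, pairCode_swap G y x', T.flag (x := y) (y := x) (z := x')]
      · exact hne (by omega)
      · exact hne (by omega)
      · rw [hD]
        omega
      · rw [hD]
        omega
      · rw [hD]
        omega
    have right : ∀ x y m, idx x + 2 ≤ m → idx y = m + 1 →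
        ∃ y', idx y' = m ∧ pairCode G x y = pairCode G x y' := by
      intro x y m h hm
      obtain ⟨y', hy'⟩ := hdown y m hm
      refine ⟨y', hy', T.flag ?_ ?_ ?_ ?_ ?_⟩
      · exact hne (by omega)
      · exact hne (by omega)
      · rw [hD]
        omega
      · rw [hD]
        omega
      · rw [hD]
        omega
    have base : ∀ n x y, idx x + idx y = n → idx x + 2 ≤ idx y →
        ∃ x₀ y₀, idx x₀ = 0 ∧ idx y₀ = 2 ∧ pairCode G x y = pairCode G x₀ y₀ := by
      intro n
      induction n with
      | zero => intro x y h1 h2; omega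
      | succ n ih =>
        intro x y h1 h2
        cases hx : idx x with
        | succ m =>
          obtain ⟨x', hx', he⟩ := left x y h2 m hx
          rw [he]
          exact ih x' y (by omega) (by omega)
        | zero =>
          by_cases hy : idx y = 2
          · exact ⟨x, y, hx, hy, rfl⟩
          · obtain ⟨y', hy', he⟩ := right x y (idx y - 1) (by omega) (by omega)
            rw [he]
            exact ih x y' (by omega) (by omega)
    intro _ x y x' y' _ h h'
    obtain ⟨a, b, ha, hb, e⟩ := base _ x y rfl h
    obtain ⟨a', b', ha', hb', e'⟩ := base _ x' y' rfl h'
    rw [e, e', hinj (ha.trans ha'.symm), hinj (hb.trans hb'.symm)]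
  obtain ⟨full, hfull⟩ : ∃ full : Bool, ∀ x y, idx x + 2 ≤ idx y →
      pairCode G x y = if full then 3 else 0 := by
    by_cases hex : ∃ x y, idx x + 2 ≤ idx y
    · obtain ⟨x, y, hxy⟩ := hex
      have hn : ¬ G.Dir x y := by
        rw [hD]
        omega
      rcases ntlCode_of_not_dir hn with h | h
      · exact ⟨false, fun x' y' h' => (hneutral _ x' y' x y rfl h' hxy).trans h⟩
      · exact ⟨true, fun x' y' h' => (hneutral _ x' y' x y rfl h' hxy).trans h⟩
    · exact ⟨false, fun x y h => absurd ⟨x, y, h⟩ hex⟩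
  refine ⟨idx, full, hinj, fun x y => ?_, ?_⟩
  · change _ ↔ idx x ≠ idx y ∧ (idx x + 1 = idx y ∨
      (full = true ∧ (idx x + 1 < idx y ∨ idx y + 1 < idx x)))
    rw [arc_iff_pairCode]
    rcases lt_trichotomy (idx x) (idx y) with h | h | h
    · by_cases h1 : idx x + 1 = idx y
      · rw [(hto x y).2 h1]
        simp only [true_or, true_iff]
        omega
      · rw [hfull x y (by omega)]
        cases full <;> simp <;> omega
    · rw [hinj h, pairCode_self]
      simp
    · by_cases h1 : idx y + 1 = idx x
      · rw [pairCode_swap G y x, (hto y x).2 h1]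
        simp only [swapCode]
        omega
      · rw [pairCode_swap G y x, hfull y x (by omega)]
        cases full <;> simp [swapCode] <;> omega
  · intro y m hm
    induction hn : idx y - m generalizing m with
    | zero => exact ⟨y, by omega⟩
    | succ n ih =>
      obtain ⟨x, hx⟩ := ih (m + 1) (by omega) (by omega)
      exact hdown x m hx

theorem of_source {v : W} (hv : ∀ x, pairCode G x v ≠ 1) :
    SelfDual G ∨ ∃ full, Iso G (consecNat full) := by
  obtain ⟨idx, full, hinj, harc, hdown⟩ := T.exists_eq_comap hv
  by_cases hsurj : Function.Surjective idx
  · exact Or.inr ⟨full, Equiv.ofBijective idx ⟨hinj, hsurj⟩, harc⟩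
  left
  obtain ⟨m, hm⟩ := not_forall.1 hsurj
  have hlt : ∀ x, idx x < m := fun x => by
    by_contra h
    exact hm (hdown x m (by omega))
  obtain ⟨M, hM⟩ : ∃ M, ∀ n, (∃ x, idx x = n) ↔ n < M := by
    classical
    refine ⟨Nat.find (p := fun n => ¬ ∃ x, idx x = n) ⟨m, hm⟩, fun n => ⟨fun ⟨x, hx⟩ => ?_,
      fun hn => ?_⟩⟩
    · by_contra h
      exact Nat.find_spec (p := fun n => ¬ ∃ x, idx x = n) ⟨m, hm⟩ (hdown x _ (by omega))
    · simpa using Nat.find_min (p := fun n => ¬ ∃ x, idx x = n) ⟨m, hm⟩ hn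
  have hlt : ∀ x, idx x < M := fun x => (hM _).1 ⟨x, rfl⟩
  choose r hr using fun x => (hM (M - 1 - idx x)).2 (by have := hlt x; omega)
  have hrr : Function.Involutive r := fun x => hinj (by
    rw [hr, hr]
    have := hlt x
    omega)
  refine ⟨hrr.toPerm, fun x y => ?_⟩
  change G.Arc x y ↔ G.Arc (r y) (r x)
  rw [harc, harc, hr, hr]
  change idx x ≠ idx y ∧ (idx x + 1 = idx y ∨
      (full = true ∧ (idx x + 1 < idx y ∨ idx y + 1 < idx x))) ↔ _ ≠ _ ∧ (_ + 1 = _ ∨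
      (full = true ∧ (_ + 1 < _ ∨ _ + 1 < _)))
  have := hlt x
  have := hlt y
  cases full
  · simp
    omega
  · simp
    omega

end Threadlike

theorem Iso.pairCode_eq {G : Dgraph V} {H : Dgraph W} {e : V ≃ W}
    (he : ∀ x y, G.Arc x y ↔ H.Arc (e x) (e y)) (x y : V) :
    pairCode G x y = pairCode H (e x) (e y) :=
  pairCode_congr (he x y) (he y x)

theorem SelfDual.of_dual {G : Dgraph W} (h : SelfDual G.dual) : SelfDual G := Iso.dual h

namespace Threadlike

variable {G : Dgraph W} (T : Threadlike G)
include T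

theorem selfDual_of_no_end {x₀ y₀ z₀ : W} (hxy : x₀ ≠ y₀) (hxz : x₀ ≠ z₀) (hyz : y₀ ≠ z₀)
    (nxy : ¬ G.Dir x₀ y₀) (nxz : ¬ G.Dir x₀ z₀) (hsource : ∀ x, ∃ y, pairCode G y x = 1)
    (hsink : ∀ x, ∃ y, pairCode G x y = 1) : SelfDual G := by
  choose s hs using hsink
  choose p hp using hsource
  let σ : Equiv.Perm W := ⟨s, p, fun x => T.in_unique (hp _) (hs x),
    fun x => T.out_unique (hs _) (hp x)⟩
  have hσ : ∀ x, pairCode G x (σ x) = 1 := hs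
  have hD : ∀ x y, G.Dir x y ↔ y = σ x ∨ x = σ y := by
    intro x y
    rw [dir_iff_pairCode]
    constructor
    · rintro (h | h)
      · exact Or.inl (T.out_unique h (hσ x))
      · refine Or.inr (T.out_unique ?_ (hσ y))
        rw [pairCode_swap, h]
        rfl
    · rintro (h | h)
      · exact Or.inl (h ▸ hσ x)
      · right
        rw [h, pairCode_swap, hσ]
        rfl
  have hDσ : ∀ x, G.Dir x (σ x) := fun x => (hD _ _).2 (Or.inl rfl)
  have hshort : ∀ x, σ (σ (σ (σ x))) ≠ x := by
    intro x h4
    have hall : ∀ w, w = x ∨ w = σ x ∨ w = σ (σ x) ∨ w = σ (σ (σ x)) := by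
      intro w
      induction T.conn x w with
      | refl => exact Or.inl rfl
      | tail _ h ih =>
        rcases (hD _ _).1 h with h | h
        · rcases ih with rfl | rfl | rfl | rfl
          · exact Or.inr (Or.inl h)
          · exact Or.inr (Or.inr (Or.inl h))
          · exact Or.inr (Or.inr (Or.inr h))
          · exact Or.inl (h.trans h4)
        · rcases ih with e | e | e | e
          · exact Or.inr (Or.inr (Or.inr (σ.injective (by rw [← h, h4, e]))))
          · exact Or.inl (σ.injective (by rw [← h, e]))
          · exact Or.inr (Or.inl (σ.injective (by rw [← h, e])))
          · exact Or.inr (Or.inr (Or.inl (σ.injective (by rw [← h, e]))))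
    have h4' : ∀ w, σ (σ (σ (σ w))) = w := by
      intro w
      rcases hall w with rfl | rfl | rfl | rfl <;> simp only [h4]
    have opp : ∀ w w', w ≠ w' → ¬ G.Dir w w' → w' = σ (σ w) := by
      intro w w' hne hn
      rw [hD, not_or] at hn
      rcases hall w with rfl | rfl | rfl | rfl <;> rcases hall w' with rfl | rfl | rfl | rfl <;>
        simp_all
    exact hyz ((opp x₀ y₀ hxy nxy).trans (opp x₀ z₀ hxz nxz).symm)
  have hone : ∀ x y, x ≠ y → ¬ G.Dir x y → x ≠ σ (σ y) →
      pairCode G x y = pairCode G (σ x) (σ y) := by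
    intro x y hne hn h2
    rw [hD, not_or] at hn
    have e1 : pairCode G x y = pairCode G x (σ y) := by
      refine T.flag hne hn.2 ?_ ?_ (hDσ y)
      · rwa [hD, not_or]
      · rw [hD, not_or]
        exact ⟨fun h => hne (σ.injective h).symm, h2⟩
    have e2 : pairCode G (σ y) x = pairCode G (σ y) (σ x) := by
      refine T.flag (fun h => hn.2 h.symm) (fun h => hne (σ.injective h).symm) ?_ ?_ (hDσ x)
      · rw [hD, not_or]
        exact ⟨h2, fun h => hne (σ.injective h).symm⟩
      · rw [hD, not_or]
        exact ⟨fun h => hn.2 (σ.injective h), fun h => hn.1 (σ.injective h)⟩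
    rw [e1, pairCode_swap G (σ y) x, e2, ← pairCode_swap]
  have hshift : ∀ x y, pairCode G (σ x) (σ y) = pairCode G x y := by
    intro x y
    by_cases hne : x = y
    · rw [hne, pairCode_self, pairCode_self]
    by_cases hd : G.Dir x y
    · rcases (hD x y).1 hd with rfl | rfl
      · rw [hσ, hσ]
      · rw [pairCode_swap G (σ y), pairCode_swap G y, hσ, hσ]
    by_cases h2 : x = σ (σ y)
    · have h3 : y ≠ σ (σ x) := fun h => hshort y (by rw [← h2, ← h])
      rw [pairCode_swap G y x, pairCode_swap G (σ y),
        hone y x (Ne.symm hne) (fun h => hd h.symm) h3]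
    · exact (hone x y hne hd h2).symm
  have hzshift : ∀ (n : ℤ) x y, pairCode G ((σ ^ n) x) ((σ ^ n) y) = pairCode G x y := by
    intro n
    induction n with
    | zero => exact fun _ _ => rfl
    | succ n ih =>
      intro x y
      rw [zpow_add_one, Equiv.Perm.mul_apply, Equiv.Perm.mul_apply, ih, hshift]
    | pred n ih =>
      intro x y
      rw [zpow_sub_one, Equiv.Perm.mul_apply, Equiv.Perm.mul_apply, ih, ← hshift,
        Equiv.Perm.inv_def, Equiv.apply_symm_apply, Equiv.apply_symm_apply]
  have hall : ∀ x, ∃ n : ℤ, (σ ^ n) x₀ = x := by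
    intro x
    induction T.conn x₀ x with
    | refl => exact ⟨0, rfl⟩
    | tail _ h ih =>
      obtain ⟨n, rfl⟩ := ih
      rcases (hD _ _).1 h with h | h
      · exact ⟨1 + n, by rw [zpow_add, zpow_one, Equiv.Perm.mul_apply, h]⟩
      · refine ⟨-1 + n, ?_⟩
        rw [zpow_add, Equiv.Perm.mul_apply, h, zpow_neg_one, Equiv.Perm.inv_def,
          Equiv.symm_apply_apply]
  choose k hk using hall
  have hneg : ∀ m n : ℤ, (σ ^ m) x₀ = (σ ^ n) x₀ → (σ ^ (-m)) x₀ = (σ ^ (-n)) x₀ := by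
    intro m n h
    have := congrArg (σ ^ (-m + -n)) h
    rw [← Equiv.Perm.mul_apply, ← Equiv.Perm.mul_apply, ← zpow_add, ← zpow_add] at this
    rw [show -m = -m + -n + n by ring, ← this]
    congr 2
    ring
  have hinv : Function.Involutive fun x => (σ ^ (-k x)) x₀ := by
    intro x
    have := hneg _ _ (hk ((σ ^ (-k x)) x₀))
    rw [neg_neg, hk] at this
    exact this
  refine ⟨hinv.toPerm, fun x y => arc_iff_of_pairCode_eq ?_⟩
  change _ = pairCode G ((σ ^ (-k y)) x₀) ((σ ^ (-k x)) x₀)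
  rw [← hzshift (k x + k y) ((σ ^ (-k y)) x₀), ← Equiv.Perm.mul_apply,
    ← Equiv.Perm.mul_apply, ← zpow_add, ← zpow_add, show k x + k y + -k y = k x by ring, show k x + k y + -k x = k y by ring, hk, hk]

theorem selfDual_or_oneEnd {x₀ y₀ z₀ : W} (hxy : x₀ ≠ y₀) (hxz : x₀ ≠ z₀) (hyz : y₀ ≠ z₀)
    (nxy : ¬ G.Dir x₀ y₀) (nxz : ¬ G.Dir x₀ z₀) :
    SelfDual G ∨ G.OneEndInfiniteConsecutivity := by
  by_cases hsource : ∀ x, ∃ y, pairCode G y x = 1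
  · by_cases hsink : ∀ x, ∃ y, pairCode G x y = 1
    · exact Or.inl (T.selfDual_of_no_end hxy hxz hyz nxy nxz hsource hsink)
    · push Not at hsink
      obtain ⟨v, hv⟩ := hsink
      rcases T.dual.of_source (v := v) hv with h | ⟨full, h⟩
      · exact Or.inl h.of_dual
      · exact Or.inr ⟨full, Or.inr h.dual⟩
  · push Not at hsource
    obtain ⟨v, hv⟩ := hsource
    rcases T.of_source hv with h | ⟨full, h⟩
    · exact Or.inl h
    · exact Or.inr ⟨full, Or.inl h⟩

end Threadlike

theorem LocalSelf.selfDual_or_oneEnd {G : Dgraph W} (L : LocalSelf G) (hG : G.ArcConnected)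
    {x y z : W} (hxy : x ≠ y) (hxz : x ≠ z) (hyz : y ≠ z) (nxy : ¬ G.Dir x y)
    (nxz : ¬ G.Dir x z) : SelfDual G ∨ G.OneEndInfiniteConsecutivity := by
  obtain ⟨u, v, w, h1, h2, h3⟩ := L.exists_neutral_dir hG hxy hxz hyz nxy nxz
  exact (L.threadlike hG h1 h2 h3).selfDual_or_oneEnd hxy hxz hyz nxy nxz

theorem iso_comap_equiv (e : W ≃ V) (G : Dgraph V) : Iso (comap e G) G :=
  ⟨e, fun _ _ => Iff.rfl⟩

theorem HemiSix.hemi [Finite V] {G G' : Dgraph V} (h : HemiSix G G') (hV : Nat.card V ≤ 6) :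
    Hemi G G' := by
  have e := (Finite.equivFin V).symm
  rcases h _ hV e e.injective with h1 | h1
  · exact Or.inl (((iso_comap_equiv e G).symm.trans h1).trans (iso_comap_equiv e G'))
  · exact Or.inr (((iso_comap_equiv e G).dual.symm.trans h1).trans (iso_comap_equiv e G'))

theorem HemiSix.selfDual_of_card_le [Finite W] {b : Bool} {G : Dgraph W}
    (h : HemiSix (addPt b G) (addPt b G.dual)) (hW : Nat.card W ≤ 5)
    (hout : ∀ x, ∃ y, pairCode G x y = 1) (hin : ∀ x, ∃ y, pairCode G x y = 2) :
    SelfDual G := by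
  have h6 : Nat.card (Option W) ≤ 6 := by
    rw [Finite.card_option]
    omega
  have key : ∀ (H : Dgraph (Option W)) (c : ℕ), (∀ x, pairCode H none (some x) = c) →
      ∀ e : Option W ≃ Option W, (∀ x y, H.Arc x y ↔ (addPt b G.dual).Arc (e x) (e y)) →
      e none = none := by
    intro H c hc e he
    by_contra hne
    obtain ⟨w, hw⟩ := Option.ne_none_iff_exists'.1 hne
    have hall : ∀ u, u ≠ w → swapCode (pairCode G w u) = c := by
      intro u hu
      have h1 : e.symm (some u) ≠ none := fun h2 => by
        rw [Equiv.symm_apply_eq, hw] at h2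
        exact hu (Option.some_injective _ h2)
      obtain ⟨x, hx⟩ := Option.ne_none_iff_exists'.1 h1
      have h3 := hc x
      rw [← hx, Iso.pairCode_eq he, Equiv.apply_symm_apply, hw, pairCode_addPt_some,
        pairCode_dual] at h3
      exact h3
    obtain ⟨u, hu⟩ := hout w
    obtain ⟨u', hu'⟩ := hin w
    have h1 := hall u (ne_of_dirCode (Or.inl hu)).symm
    have h2 := hall u' (ne_of_dirCode (Or.inr hu')).symm
    rw [hu] at h1
    rw [hu', ← h1] at h2
    simp [swapCode] at h2
  rcases h.hemi h6 with ⟨e, he⟩ | ⟨e, he⟩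
  · have hn := key _ _ (pairCode_addPt_none b G) e he
    have hsome : ∀ x, some (e.removeNone x) = e (some x) := fun x =>
      e.removeNone_some (Option.ne_none_iff_exists'.1 fun h => by
        rw [← hn] at h
        simpa using e.injective h)
    refine ⟨e.removeNone, fun x y => ?_⟩
    have := he (some x) (some y)
    rw [← hsome, ← hsome] at this
    exact this
  · have hd : ∀ x, pairCode (addPt b G).dual none (some x) = if b then 2 else 1 := by
      intro x
      rw [pairCode_dual, pairCode_addPt_none]
      cases b <;> rfl
    have hn := key _ _ hd e he
    have hne : IsEmpty W := by
      refine ⟨fun x => ?_⟩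
      have h1 := hd x
      rw [Iso.pairCode_eq he, hn] at h1
      have h2 : e (some x) ≠ none := fun h => by
        rw [← hn] at h
        simpa using e.injective h
      obtain ⟨y, hy⟩ := Option.ne_none_iff_exists'.1 h2
      rw [hy, pairCode_addPt_none] at h1
      cases b <;> simp at h1
    exact ⟨Equiv.refl W, fun x => (hne.false x).elim⟩

/-- The neutral pairs form a matching, which contains the pair `{a, a'}`. -/
structure NeutralMatching (G : Dgraph W) (a a' : W) : Prop where
  loc : LocalSelf G
  ne : a ≠ a'
  neutral : ¬ G.Dir a a'
  unique : ∀ {x y z : W}, x ≠ y → x ≠ z → ¬ G.Dir x y → ¬ G.Dir x z → y = z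

namespace NeutralMatching

/-- The vertices between `a` and `a'`. -/
def Mid (G : Dgraph W) (a a' x : W) : Prop := pairCode G a x = 1 ∧ pairCode G a' x = 2

variable {G : Dgraph W} {a a' : W} (N : NeutralMatching G a a')
include N

theorem symm : NeutralMatching G a' a := ⟨N.loc, N.ne.symm, fun h => N.neutral h.symm, N.unique⟩

theorem cases (w : W) : w = a ∨ w = a' ∨ Mid G a a' w ∨ Mid G a' a w := by
  by_contra! hcon
  obtain ⟨h1, h2, h3, h4⟩ := hcon
  have d1 : G.Dir w a := by
    by_contra h
    exact h2 (N.unique N.ne (Ne.symm h1) N.neutral fun h' => h h'.symm).symm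
  have d2 : G.Dir w a' := by
    by_contra h
    exact h1 (N.symm.unique N.ne.symm (Ne.symm h2) (fun h' => N.neutral h'.symm)
      fun h' => h h'.symm).symm
  have c1 := dir_iff_pairCode.1 d1.symm
  have c2 := dir_iff_pairCode.1 d2.symm
  refine N.neutral (N.loc.peak d1 ?_ N.ne)
  rw [pairCode_swap G a', pairCode_swap G a]
  congr 1
  unfold Mid at h3 h4
  omega

theorem mid_dir {x y : W} (hx : Mid G a a' x) (hy : Mid G a a' y) (hne : x ≠ y) : G.Dir x y :=
  N.loc.peak (dir_iff_pairCode.2 (Or.inl hx.1)) (hy.1.trans hx.1.symm) hne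

theorem mid_trans {x y z : W} (hx : Mid G a a' x) (hy : Mid G a a' y) (hz : Mid G a a' z)
    (hxy : pairCode G x y = 1) (hyz : pairCode G y z = 1) : pairCode G x z = 1 := by
  have hxz : x ≠ z := by
    rintro rfl
    rw [pairCode_swap, hxy] at hyz
    simp [swapCode] at hyz
  refine (dir_iff_pairCode.1 (N.mid_dir hx hz hxz)).resolve_right fun h => ?_
  exact N.loc.diamond (dir_iff_pairCode.2 (Or.inl hx.1)) (hy.1.trans hx.1.symm)
    (hz.1.trans hx.1.symm) (dir_iff_pairCode.2 (Or.inl hxy)) (by rw [h, hxy]; rfl)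
    (hyz.trans hxy.symm)

theorem mid_code {x y : W} (hx : Mid G a a' x) (hy : Mid G a a' y) (h : G.Arc x y) :
    pairCode G x y = 1 := by
  have hne : x ≠ y := by
    rintro rfl
    exact G.irrefl _ h
  rw [pairCode_eq_one]
  exact (N.mid_dir hx hy hne).resolve_right fun h' => h'.2 h

theorem selfDual_of_mid (hfin : NoInfChain G) (h : ∀ x, ¬ Mid G a' a x) : SelfDual G := by
  classical
  have hcases : ∀ w, w = a ∨ w = a' ∨ Mid G a a' w := fun w => by
    have := h w
    have := N.cases w
    tauto
  have ha : ∀ {w}, Mid G a a' w → w ≠ a := by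
    rintro w hw rfl
    simp [Mid, pairCode_self] at hw
  have ha' : ∀ {w}, Mid G a a' w → w ≠ a' := by
    rintro w hw rfl
    simp [Mid, pairCode_self] at hw
  let f : W → Fin 3 := fun w => if w = a then 0 else if w = a' then 1 else 2
  have fa : f a = 0 := if_pos rfl
  have fa' : f a' = 1 := by simp [f, N.ne.symm]
  have fm : ∀ {w}, Mid G a a' w → f w = 2 := fun hw => by simp [f, ha hw, ha' hw]
  have fm' : ∀ {x y}, f x = f y → x ≠ y → Mid G a a' x ∧ Mid G a a' y := by
    intro x y hxy hne
    rcases hcases x with rfl | rfl | hx <;> rcases hcases y with rfl | rfl | hy <;>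
      simp_all
  have hsm : ∀ {w}, Mid G a a' w → Equiv.swap a a' w = w := fun hw =>
    Equiv.swap_apply_of_ne_of_ne (ha hw) (ha' hw)
  have caa : swapCode (pairCode G a' a) = pairCode G a a' := (pairCode_swap G a' a).symm
  have caa' : swapCode (pairCode G a a') = pairCode G a' a := (pairCode_swap G a a').symm
  have neut : pairCode G a' a = pairCode G a a' := by
    rw [pairCode_swap]
    rcases ntlCode_of_not_dir N.neutral with e | e <;> rw [e] <;> rfl
  have hCF : ChainFibers f G (comap (Equiv.swap a a') G.dual) := by
    refine ⟨fun x y z hyz hxy => ?_, fun x y hxy => ?_, fun x y hxy hne => ?_,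
      fun x y hxy hne => ?_, fun x y z hxy hyz h1 h2 => ?_, fun x y z hxy hyz h1 h2 => ?_⟩
    · by_cases he : y = z
      · rw [he]
      · obtain ⟨hy, hz⟩ := fm' hyz he
        rcases hcases x with rfl | rfl | hx
        · exact hy.1.trans hz.1.symm
        · exact hy.2.trans hz.2.symm
        · exact absurd ((fm hx).trans (fm hy).symm) hxy
    · change pairCode G x y = pairCode G.dual (Equiv.swap a a' x) (Equiv.swap a a' y)
      rw [pairCode_dual]
      rcases hcases x with rfl | rfl | hx <;> rcases hcases y with rfl | rfl | hy
      · exact absurd rfl hxy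
      · rw [Equiv.swap_apply_left, Equiv.swap_apply_right, caa]
      · rw [Equiv.swap_apply_left, hsm hy, hy.1, hy.2]
        rfl
      · rw [Equiv.swap_apply_left, Equiv.swap_apply_right, caa']
      · exact absurd rfl hxy
      · rw [Equiv.swap_apply_right, hsm hy, hy.1, hy.2]
        rfl
      · rw [Equiv.swap_apply_left, hsm hx, ← pairCode_swap, pairCode_swap G _ x, hx.1, hx.2]
        rfl
      · rw [Equiv.swap_apply_right, hsm hx, ← pairCode_swap, pairCode_swap G _ x, hx.1, hx.2]
        rfl
      · exact absurd ((fm hx).trans (fm hy).symm) hxy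
    · obtain ⟨hx, hy⟩ := fm' hxy hne
      exact N.mid_dir hx hy hne
    · obtain ⟨hx, hy⟩ := fm' hxy hne
      change G.Dir (Equiv.swap a a' y) (Equiv.swap a a' x)
      rw [hsm hx, hsm hy]
      exact (N.mid_dir hx hy hne).symm
    · have n1 : x ≠ y := fun he => G.irrefl _ (he ▸ h1)
      have n2 : y ≠ z := fun he => G.irrefl _ (he ▸ h2)
      obtain ⟨hx, hy⟩ := fm' hxy n1
      obtain ⟨-, hz⟩ := fm' hyz n2
      exact (pairCode_eq_one.1
        (N.mid_trans hx hy hz (N.mid_code hx hy h1) (N.mid_code hy hz h2))).1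
    · have n1 : x ≠ y := fun he => G.irrefl _ (he ▸ h1)
      have n2 : y ≠ z := fun he => G.irrefl _ (he ▸ h2)
      obtain ⟨hx, hy⟩ := fm' hxy n1
      obtain ⟨-, hz⟩ := fm' hyz n2
      change G.Arc (Equiv.swap a a' y) (Equiv.swap a a' x) at h1
      change G.Arc (Equiv.swap a a' z) (Equiv.swap a a' y) at h2
      change G.Arc (Equiv.swap a a' z) (Equiv.swap a a' x)
      rw [hsm hx, hsm hy] at h1
      rw [hsm hz, hsm hy] at h2
      rw [hsm hx, hsm hz]
      exact (pairCode_eq_one.1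
        (N.mid_trans hz hy hx (N.mid_code hz hy h2) (N.mid_code hy hx h1))).1
  refine (hCF.iso fun i => ?_).trans (iso_comap_equiv _ _)
  have hmid : {x | Mid G a a' x}.Finite := by
    refine hfin _ (isInterval_of_pairCode fun x hx => ?_) ⟨?_, ?_⟩
    · rcases hcases x with rfl | rfl | h
      · exact ⟨1, fun y hy => hy.1⟩
      · exact ⟨2, fun y hy => hy.2⟩
      · exact absurd h hx
    · exact fun x y hne => N.mid_dir x.2 y.2 (Subtype.coe_injective.ne hne)
    · exact fun x y z h1 h2 => (pairCode_eq_one.1 (N.mid_trans x.2 y.2 z.2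
        (N.mid_code x.2 y.2 h1) (N.mid_code y.2 z.2 h2))).1
  refine (((Set.finite_singleton a').union hmid).union (Set.finite_singleton a)).subset
    fun x _ => ?_
  rcases hcases x with h | h | h
  · exact Or.inr h
  · exact Or.inl (Or.inl h)
  · exact Or.inl (Or.inr h)

end NeutralMatching

namespace NeutralMatching

variable {G : Dgraph W} {a a' : W} (N : NeutralMatching G a a')
theorem mid_ne {x t : W} (hx : Mid G a a' x) (ht : Mid G a' a t) : t ≠ x := by
  rintro rfl
  have := hx.1.symm.trans ht.2
  omega

include N

theorem square {x y t : W} (hx : Mid G a a' x) (hy : Mid G a a' y) (ht : Mid G a' a t)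
    (hxy : pairCode G x y = 1) :
    (G.Dir t x ∨ G.Dir t y) ∧ (pairCode G t x = 1 ∨ ¬ G.Dir t x) ∧
      (pairCode G t y = 2 ∨ ¬ G.Dir t y) := by
  have hd : G.Dir t x ∨ G.Dir t y := by
    by_contra! h
    exact ne_of_dirCode (Or.inl hxy) (N.unique (mid_ne hx ht) (mid_ne hy ht) h.1 h.2)
  exact ⟨hd, N.loc.square N.ne N.neutral hx.1 hx.2 hy.1 hy.2 ht.2 ht.1 hxy hd⟩

theorem no_three_aux {x y z t : W} (hx : Mid G a a' x) (hy : Mid G a a' y) (hz : Mid G a a' z)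
    (ht : Mid G a' a t) (hxy : pairCode G x y = 1) (hyz : pairCode G y z = 1) : False := by
  have hxz := N.mid_trans hx hy hz hxy hyz
  have h1 := N.square hx hy ht hxy
  have h2 := N.square hx hz ht hxz
  have h3 := N.square hy hz ht hyz
  have d1 : ¬ G.Dir t y := by
    rcases h1.2.2 with e | e
    · rcases h3.2.1 with e' | e'
      · omega
      · exact e'
    · exact e
  have d2 := h1.1.resolve_right d1
  have d3 := h3.1.resolve_left d1
  have c1 := h1.2.1.resolve_right fun h => h d2
  have c3 := h3.2.2.resolve_right fun h => h d3
  refine N.loc.triple hx.2 hy.2 hz.2 ht.1 hxy hxz hyz ?_ (mid_ne hy ht)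
    (fun h => d1 h.symm) ?_
  · rw [pairCode_swap, c1]
    rfl
  · rw [pairCode_swap, c3]
    rfl

theorem no_three {x y z t : W} (hx : Mid G a a' x) (hy : Mid G a a' y) (hz : Mid G a a' z)
    (ht : Mid G a' a t) (hxy : x ≠ y) (hxz : x ≠ z) (hyz : y ≠ z) : False := by
  have sw : ∀ {x y}, pairCode G x y = 2 → pairCode G y x = 1 := fun h => by
    rw [pairCode_swap, h]
    rfl
  rcases dir_iff_pairCode.1 (N.mid_dir hx hy hxy) with e1 | e1 <;>
  rcases dir_iff_pairCode.1 (N.mid_dir hx hz hxz) with e2 | e2 <;>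
  rcases dir_iff_pairCode.1 (N.mid_dir hy hz hyz) with e3 | e3
  · exact N.no_three_aux hx hy hz ht e1 e3
  · exact N.no_three_aux hx hz hy ht e2 (sw e3)
  · exact N.no_three_aux hx hy hz ht e1 e3
  · exact N.no_three_aux hz hx hy ht (sw e2) e1
  · exact N.no_three_aux hy hx hz ht (sw e1) e2
  · exact N.no_three_aux hx hz hy ht e2 (sw e3)
  · exact N.no_three_aux hy hz hx ht e3 (sw e2)
  · exact N.no_three_aux hz hy hx ht (sw e3) (sw e1)

theorem exists_out {s t : W} (hs : Mid G a a' s) (ht : Mid G a' a t) (x : W) :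
    ∃ y, pairCode G x y = 1 := by
  rcases N.cases x with rfl | rfl | h | h
  · exact ⟨s, hs.1⟩
  · exact ⟨t, ht.1⟩
  · exact ⟨a', by rw [pairCode_swap, h.2]; rfl⟩
  · exact ⟨a, by rw [pairCode_swap, h.2]; rfl⟩

theorem exists_in {s t : W} (hs : Mid G a a' s) (ht : Mid G a' a t) (x : W) :
    ∃ y, pairCode G x y = 2 := by
  rcases N.cases x with rfl | rfl | h | h
  · exact ⟨t, ht.2⟩
  · exact ⟨s, hs.2⟩
  · exact ⟨a, by rw [pairCode_swap, h.1]; rfl⟩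
  · exact ⟨a', by rw [pairCode_swap, h.1]; rfl⟩

theorem exists_pair {s t : W} (hs : Mid G a a' s) (ht : Mid G a' a t) :
    ∃ s', Mid G a a' s' ∧ ∀ x, Mid G a a' x → x = s ∨ x = s' := by
  by_cases h : ∃ s', Mid G a a' s' ∧ s' ≠ s
  · obtain ⟨s', h1, h2⟩ := h
    refine ⟨s', h1, fun x hx => ?_⟩
    by_contra! hcon
    exact N.no_three hs h1 hx ht h2.symm hcon.1.symm hcon.2.symm
  · push Not at h
    exact ⟨s, hs, fun x hx => Or.inl (h x hx)⟩

theorem selfDual_of_single {b : Bool} (h : HemiSix (addPt b G) (addPt b G.dual)) {s s' t : W}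
    (hs : Mid G a a' s) (ht : Mid G a' a t) (hall : ∀ x, Mid G a a' x → x = s ∨ x = s')
    (hall' : ∀ x, Mid G a' a x → x = t) : SelfDual G := by
  have hsurj : Function.Surjective ![a, a', s, s', t] := by
    intro w
    rcases N.cases w with h | h | h | h
    · exact ⟨0, h.symm⟩
    · exact ⟨1, h.symm⟩
    · rcases hall w h with h | h
      · exact ⟨2, h.symm⟩
      · exact ⟨3, h.symm⟩
    · exact ⟨4, (hall' w h).symm⟩
  have := Finite.of_surjective _ hsurj
  refine h.selfDual_of_card_le ?_ (N.exists_out hs ht) (N.exists_in hs ht)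
  have := Nat.card_le_card_of_surjective _ hsurj
  exact this.trans (by simp)

theorem selfDual_of_hexagon {s s' t t' : W} (hs : Mid G a a' s) (hs' : Mid G a a' s')
    (ht : Mid G a' a t) (ht' : Mid G a' a t') (hall : ∀ x, Mid G a a' x → x = s ∨ x = s')
    (hall' : ∀ x, Mid G a' a x → x = t ∨ x = t') (hss : pairCode G s s' = 1)
    (htt : pairCode G t t' = 1) : SelfDual G := by
  classical
  have q1 := N.square hs hs' ht hss
  have q2 := N.square hs hs' ht' hss
  have q3 := N.symm.square ht ht' hs htt
  have q4 := N.symm.square ht ht' hs' htt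
  have sw : ∀ x y, pairCode G x y = swapCode (pairCode G y x) := fun x y => pairCode_swap G y x
  have nst : ¬ G.Dir t s := by
    rcases q1.2.1 with e | e
    · rcases q3.2.1 with e' | e'
      · rw [sw, e'] at e
        simp [swapCode] at e
      · exact fun h => e' h.symm
    · exact e
  have cts' := q1.2.2.resolve_right fun h => h (q1.1.resolve_left nst)
  have cst' := q3.2.2.resolve_right fun h => h (q3.1.resolve_left fun h => nst h.symm)
  have nst' : ¬ G.Dir t' s' := by
    rcases q2.2.2 with e | e
    · rcases q4.2.2 with e' | e'
      · rw [sw, e'] at e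
        simp [swapCode] at e
      · exact fun h => e' h.symm
    · exact e
  have hexa := N.loc.hexagon N.ne (mid_ne hs ht).symm N.neutral (fun h => nst h.symm)
    hs.1 hs.2 hs'.1 hs'.2 ht.2 ht.1 hss cts'
  have neut : ∀ {x y}, ¬ G.Dir x y → pairCode G y x = pairCode G x y := fun {x y} h => by
    rw [pairCode_swap G x y]
    rcases ntlCode_of_not_dir h with e | e <;> rw [e] <;> rfl
  have e1 : pairCode G t s = pairCode G a a' := (neut nst).symm.trans hexa.symm
  have e2 := neut N.neutral
  have e3 := neut nst'
  have pa : ∀ {x}, Mid G a a' x → x ≠ a ∧ x ≠ a' := by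
    rintro x hx
    constructor <;> rintro rfl <;> simp [Mid, pairCode_self] at hx
  have pa' : ∀ {x}, Mid G a' a x → x ≠ a' ∧ x ≠ a := by
    rintro x hx
    constructor <;> rintro rfl <;> simp [Mid, pairCode_self] at hx
  have hse := ne_of_dirCode (Or.inl hss)
  have hte := ne_of_dirCode (Or.inl htt)
  let φ : Equiv.Perm W := (Equiv.swap s a').trans (Equiv.swap a t)
  have f1 : φ a = t := by
    simp only [φ, Equiv.trans_apply, Equiv.swap_apply_of_ne_of_ne (pa hs).1.symm N.ne,
      Equiv.swap_apply_left]
  have f2 : φ a' = s := by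
    simp only [φ, Equiv.trans_apply, Equiv.swap_apply_right,
      Equiv.swap_apply_of_ne_of_ne (pa hs).1 (mid_ne hs ht).symm]
  have f3 : φ s = a' := by
    simp only [φ, Equiv.trans_apply, Equiv.swap_apply_left,
      Equiv.swap_apply_of_ne_of_ne N.ne.symm (pa' ht).1.symm]
  have f4 : φ t = a := by
    simp only [φ, Equiv.trans_apply, Equiv.swap_apply_of_ne_of_ne (mid_ne hs ht) (pa' ht).1,
      Equiv.swap_apply_right]
  have f5 : φ s' = s' := by
    simp only [φ, Equiv.trans_apply, Equiv.swap_apply_of_ne_of_ne hse.symm (pa hs').2,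
      Equiv.swap_apply_of_ne_of_ne (pa hs').1 (mid_ne hs' ht).symm]
  have f6 : φ t' = t' := by
    simp only [φ, Equiv.trans_apply, Equiv.swap_apply_of_ne_of_ne (mid_ne hs ht') (pa' ht').1,
      Equiv.swap_apply_of_ne_of_ne (pa' ht').2 hte.symm]
  have hcode : ∀ x y, pairCode G x y = pairCode G (φ y) (φ x) := by
    have half : ∀ x y, pairCode G x y = pairCode G (φ y) (φ x) →
        pairCode G y x = pairCode G (φ x) (φ y) := fun x y h => by
      rw [sw, h, ← sw]
    have hself : ∀ x, pairCode G x x = pairCode G (φ x) (φ x) := fun x => by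
      rw [pairCode_self, pairCode_self]
    have hw : ∀ w, w = a ∨ w = a' ∨ w = s ∨ w = s' ∨ w = t ∨ w = t' := by
      intro w
      rcases N.cases w with h | h | h | h
      · exact Or.inl h
      · exact Or.inr (Or.inl h)
      · rcases hall w h with h | h <;> simp [h]
      · rcases hall' w h with h | h <;> simp [h]
    have c12 : pairCode G a a' = pairCode G (φ a') (φ a) := by rw [f1, f2, hexa]
    have c13 : pairCode G a s = pairCode G (φ s) (φ a) := by rw [f1, f3, hs.1, ht.1]
    have c14 : pairCode G a s' = pairCode G (φ s') (φ a) := by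
      rw [f1, f5, hs'.1, sw, cts']
      rfl
    have c15 : pairCode G a t = pairCode G (φ t) (φ a) := by rw [f1, f4]
    have c16 : pairCode G a t' = pairCode G (φ t') (φ a) := by
      rw [f1, f6, ht'.2, sw, htt]
      rfl
    have c23 : pairCode G a' s = pairCode G (φ s) (φ a') := by rw [f2, f3]
    have c24 : pairCode G a' s' = pairCode G (φ s') (φ a') := by
      rw [f2, f5, hs'.2, sw, hss]
      rfl
    have c25 : pairCode G a' t = pairCode G (φ t) (φ a') := by rw [f2, f4, ht.1, hs.1]
    have c26 : pairCode G a' t' = pairCode G (φ t') (φ a') := by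
      rw [f2, f6, ht'.1, sw, cst']
      rfl
    have c34 : pairCode G s s' = pairCode G (φ s') (φ s) := by
      rw [f3, f5, hss, sw, hs'.2]
      rfl
    have c35 : pairCode G s t = pairCode G (φ t) (φ s) := by rw [f3, f4, hexa]
    have c36 : pairCode G s t' = pairCode G (φ t') (φ s) := by
      rw [f3, f6, cst', sw, ht'.1]
      rfl
    have c45 : pairCode G s' t = pairCode G (φ t) (φ s') := by
      rw [f4, f5, hs'.1, sw, cts']
      rfl
    have c46 : pairCode G s' t' = pairCode G (φ t') (φ s') := by rw [f5, f6, e3]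
    have c56 : pairCode G t t' = pairCode G (φ t') (φ t) := by
      rw [f4, f6, htt, sw, ht'.2]
      rfl
    intro x y
    rcases hw x with rfl | rfl | rfl | rfl | rfl | rfl <;>
    rcases hw y with rfl | rfl | rfl | rfl | rfl | rfl <;>
    first | exact hself _ | assumption | (apply half; assumption)
  exact ⟨φ, fun x y => arc_iff_of_pairCode_eq (hcode x y)⟩

theorem selfDual {b : Bool} (h : HemiSix (addPt b G) (addPt b G.dual)) (hfin : NoInfChain G) :
    SelfDual G := by
  by_cases h1 : ∀ x, ¬ Mid G a' a x
  · exact N.selfDual_of_mid hfin h1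
  by_cases h2 : ∀ x, ¬ Mid G a a' x
  · exact N.symm.selfDual_of_mid hfin h2
  push Not at h1 h2
  obtain ⟨t, ht⟩ := h1
  obtain ⟨s, hs⟩ := h2
  obtain ⟨s', hs', hall⟩ := N.exists_pair hs ht
  obtain ⟨t', ht', hall'⟩ := N.symm.exists_pair ht hs
  by_cases hte : t = t'
  · exact N.selfDual_of_single h hs ht hall fun x hx => by simpa [← hte] using hall' x hx
  by_cases hse : s = s'
  · exact N.symm.selfDual_of_single h ht hs hall' fun x hx => by simpa [← hse] using hall x hx
  have sw : ∀ {x y}, pairCode G x y = 2 → pairCode G y x = 1 := fun h => by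
    rw [pairCode_swap, h]
    rfl
  rcases dir_iff_pairCode.1 (N.mid_dir hs hs' hse) with e1 | e1 <;>
  rcases dir_iff_pairCode.1 (N.symm.mid_dir ht ht' hte) with e2 | e2
  · exact N.selfDual_of_hexagon hs hs' ht ht' hall hall' e1 e2
  · exact N.selfDual_of_hexagon hs hs' ht' ht hall (fun x hx => (hall' x hx).symm) e1 (sw e2)
  · exact N.selfDual_of_hexagon hs' hs ht ht' (fun x hx => (hall x hx).symm) hall' (sw e1) e2
  · exact N.selfDual_of_hexagon hs' hs ht' ht (fun x hx => (hall x hx).symm)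
      (fun x hx => (hall' x hx).symm) (sw e1) (sw e2)

end NeutralMatching

theorem LocalSelf.diamondFree {G : Dgraph W} (L : LocalSelf G) (X : Set W) :
    ¬ IsDiamond (G.ind X) := by
  have key : ∀ H : Dgraph (Fin 4), (pairCode H 0 2 = pairCode H 0 1 ∧
      pairCode H 0 3 = pairCode H 0 1 ∧ H.Dir 0 1 ∧ H.Dir 1 2 ∧
      pairCode H 1 3 = swapCode (pairCode H 1 2) ∧ pairCode H 2 3 = pairCode H 1 2) →
      ∀ e : X ≃ Fin 4, ¬ ∀ x y, (G.ind X).Arc x y ↔ H.Arc (e x) (e y) := by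
    rintro H ⟨h1, h2, h3, h4, h5, h6⟩ e he
    have hc : ∀ i j, pairCode H i j = pairCode G (e.symm i) (e.symm j) := by
      intro i j
      have := Iso.pairCode_eq he (e.symm i) (e.symm j)
      rw [e.apply_symm_apply, e.apply_symm_apply] at this
      exact this.symm
    rw [dir_iff_pairCode] at h3 h4
    simp only [hc] at h1 h2 h3 h4 h5 h6
    rw [← dir_iff_pairCode] at h3 h4
    exact L.diamond h3 h1 h2 h4 h5 h6
  have c : ∀ i j : Fin 4, diamondD.Arc i j → ¬ diamondD.Arc j i →
      pairCode diamondD i j = 1 := fun i j h h' => pairCode_eq_one.2 ⟨h, h'⟩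
  have c' : ∀ i j : Fin 4, diamondD.Arc j i → ¬ diamondD.Arc i j →
      pairCode diamondD i j = 2 := fun i j h h' => pairCode_eq_two.2 ⟨h, h'⟩
  have e01 := c 0 1 (by simp [diamondD, ofRel]) (by simp [diamondD, ofRel])
  have e02 := c 0 2 (by simp [diamondD, ofRel]) (by simp [diamondD, ofRel])
  have e03 := c 0 3 (by simp [diamondD, ofRel]) (by simp [diamondD, ofRel])
  have e12 := c 1 2 (by simp [diamondD, ofRel]) (by simp [diamondD, ofRel])
  have e23 := c 2 3 (by simp [diamondD, ofRel]) (by simp [diamondD, ofRel])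
  have e13 := c' 1 3 (by simp [diamondD, ofRel]) (by simp [diamondD, ofRel])
  rintro (⟨e, he⟩ | ⟨e, he⟩)
  · refine key diamondD ?_ e he
    simp only [dir_iff_pairCode, e01, e02, e03, e12, e13, e23, swapCode]
    simp
  · refine key diamondD.dual ?_ e fun x y => he y x
    simp only [dir_iff_pairCode, pairCode_dual, e01, e02, e03, e12, e13, e23, swapCode]
    simp

theorem HemiSix.classify {b : Bool} {G : Dgraph W} (h : HemiSix (addPt b G) (addPt b G.dual))
    (hG : G.ArcConnected) (hfin : NoInfChain G) :
    DiamondFreeTournament G ∨ SelfDual G ∨ G.OneEndInfiniteConsecutivity := by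
  have L := h.localSelf
  by_cases hT : G.IsTournament
  · exact Or.inl ⟨hT, L.diamondFree⟩
  right
  unfold IsTournament at hT
  push Not at hT
  obtain ⟨a, a', hne, hn⟩ := hT
  by_cases hu : ∀ x y z : W, x ≠ y → x ≠ z → ¬ G.Dir x y → ¬ G.Dir x z → y = z
  · exact Or.inl (NeutralMatching.selfDual ⟨L, hne, hn, hu _ _ _⟩ h hfin)
  · push Not at hu
    obtain ⟨x, y, z, h1, h2, h3, h4, h5⟩ := hu
    exact L.selfDual_or_oneEnd hG h1 h2 h5 h3 h4

theorem eq_of_arc_iff {G H : Dgraph V} (h : ∀ x y, G.Arc x y ↔ H.Arc x y) : G = H := by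
  cases G
  cases H
  congr
  exact funext fun x => funext fun y => propext (h x y)

theorem comap_eq_addPt {G : Dgraph V} {I : Set V} {z : V} {b : Bool}
    (hz : ∀ y ∈ I, pairCode G z y = if b then 1 else 2) :
    comap (fun o : Option I => o.elim z Subtype.val) G = addPt b (G.ind I) := by
  have key : ∀ a c, pairCode (comap (fun o : Option I => o.elim z Subtype.val) G) a c =
      pairCode (addPt b (G.ind I)) a c := by
    rintro (_ | x) (_ | y)
    · rw [pairCode_self, pairCode_self]
    · rw [pairCode_addPt_none]
      exact hz y y.2
    · rw [pairCode_swap _ none, pairCode_swap (addPt b (G.ind I)) none, pairCode_addPt_none]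
      exact congrArg swapCode (hz x x.2)
    · rfl
  exact eq_of_arc_iff fun x y => arc_iff_of_pairCode_eq (key x y)

theorem IsInterval.of_ind {G : Dgraph V} {I : Set V} (hI : G.IsInterval I) {J : Set I}
    (hJ : (G.ind I).IsInterval J) : G.IsInterval (Subtype.val '' J) := by
  refine isInterval_of_pairCode fun x hx => ?_
  by_cases hxI : x ∈ I
  · by_cases hne : J.Nonempty
    · obtain ⟨y₀, hy₀⟩ := hne
      refine ⟨pairCode (G.ind I) ⟨x, hxI⟩ y₀, ?_⟩
      rintro _ ⟨y, hy, rfl⟩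
      exact hJ.pairCode_eq (x := ⟨x, hxI⟩) (fun h => hx ⟨_, h, rfl⟩) hy hy₀
    · refine ⟨0, ?_⟩
      rintro _ ⟨y, hy, rfl⟩
      exact absurd ⟨y, hy⟩ hne
  · by_cases hne : I.Nonempty
    · obtain ⟨y₀, hy₀⟩ := hne
      refine ⟨pairCode G x y₀, ?_⟩
      rintro _ ⟨y, hy, rfl⟩
      exact hI.pairCode_eq hxI y.2 hy₀
    · exact ⟨0, fun y ⟨y', _⟩ => absurd ⟨_, y'.2⟩ hne⟩

theorem NoInfChain.ind {G : Dgraph V} (h : NoInfChain G) {I : Set V} (hI : G.IsInterval I) :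
    NoInfChain (G.ind I) := by
  intro J hJ hc
  refine Set.Finite.of_finite_image (h _ (hI.of_ind hJ) ⟨?_, ?_⟩) Subtype.val_injective.injOn
  · rintro ⟨_, x, hx, rfl⟩ ⟨_, y, hy, rfl⟩ hne
    exact hc.1 ⟨x, hx⟩ ⟨y, hy⟩ fun he => hne (Subtype.ext (congrArg (fun w => w.1.1) he))
  · rintro ⟨_, x, hx, rfl⟩ ⟨_, y, hy, rfl⟩ ⟨_, w, hw, rfl⟩
    exact hc.2 ⟨x, hx⟩ ⟨y, hy⟩ ⟨w, hw⟩

theorem revClass_connected {G G' : Dgraph V} (c : V) (x y : revClass G G' c) :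
    Relation.ReflTransGen (Rev (G.ind (revClass G G' c)) (G'.ind (revClass G G' c))) x y := by
  have key : ∀ (y : V) (hxy : Relation.ReflTransGen (Rev G G') x.1 y),
      ∃ hy : y ∈ revClass G G' c, Relation.ReflTransGen
        (Rev (G.ind (revClass G G' c)) (G'.ind (revClass G G' c))) x ⟨y, hy⟩ := by
    intro y hxy
    induction hxy with
    | refl => exact ⟨x.2, Relation.ReflTransGen.refl⟩
    | @tail y z _ hyz ih =>
      obtain ⟨hy, hp⟩ := ih
      exact ⟨Relation.ReflTransGen.tail hy hyz, Relation.ReflTransGen.tail hp hyz⟩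
  obtain ⟨_, h⟩ := key y (mk_eq_mk_iff.1 ((mk_eq_mk_iff.2 x.2).symm.trans (mk_eq_mk_iff.2 y.2)))
  exact h

/-- The possible behaviours of a class of the reversal relation. -/
theorem HemiSix.revClass_classify {G G' : Dgraph V} (h : HemiSix G G') (hG : G.ArcConnected)
    (hfin : NoInfChain G) {c : V} (hc : revClass G G' c ≠ Set.univ) :
    G.IsInterval (revClass G G' c) ∧
      (Iso (G.ind (revClass G G' c)) (G'.ind (revClass G G' c)) ∨
        (Iso (G.ind (revClass G G' c)).dual (G'.ind (revClass G G' c)) ∧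
          (DiamondFreeTournament (G.ind (revClass G G' c)) ∨ SelfDual (G.ind (revClass G G' c)) ∨
            (G.ind (revClass G G' c)).OneEndInfiniteConsecutivity))) := by
  obtain ⟨⟨z, k, hz⟩, hunif⟩ := h.revClass_interval hG hc
  have hI : G.IsInterval (revClass G G' c) := isInterval_of_pairCode fun x hx =>
    (hunif x hx).imp fun j hj y hy => (hj y hy).1
  refine ⟨hI, ?_⟩
  have hM := revClass_connected (G := G) (G' := G') c
  have hzI : z ∉ revClass G G' c := fun hzI => ne_of_dirCode (hz z hzI).1.1 rfl
  have hinj : Function.Injective (fun o : Option (revClass G G' c) => o.elim z Subtype.val) := by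
    rintro (_ | x) (_ | y) hxy
    · rfl
    · exact absurd (show z ∈ _ from (show z = y.1 from hxy) ▸ y.2) hzI
    · exact absurd (show z ∈ _ from (show x.1 = z from hxy) ▸ x.2) hzI
    · exact congrArg some (Subtype.ext hxy)
  obtain ⟨b, hb⟩ : ∃ b : Bool, k = if b then 1 else 2 := by
    have := hz c Relation.ReflTransGen.refl
    rcases this.1.1 with e | e
    · exact ⟨true, this.2.symm.trans e⟩
    · exact ⟨false, this.2.symm.trans e⟩
  have hadd := h.comap hinj
  rw [comap_eq_addPt fun y hy => (hz y hy).2.trans hb,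
    comap_eq_addPt fun y hy => ((hz y hy).1.2.trans (hz y hy).2).trans hb] at hadd
  refine (hadd.iso_or_selfHemi hM (hfin.ind hI)).imp_right fun ⟨hiso, hself⟩ => ⟨hiso, ?_⟩
  exact hself.classify (fun x y => Relation.ReflTransGen.mono
    (fun _ _ h => dir_iff_pairCode.2 h.1) _ _ (hM x y)) (hfin.ind hI)

/-- The digraph obtained by reversing all pairs inside `C`. -/
def reverseOn (G : Dgraph V) (C : Set V) : Dgraph V where
  Arc x y := (x ∈ C ∧ y ∈ C ∧ G.Arc y x) ∨ (¬ (x ∈ C ∧ y ∈ C) ∧ G.Arc x y)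
  irrefl x h := h.elim (fun h => G.irrefl x h.2.2) (fun h => G.irrefl x h.2)

theorem reverseOn_arc_of_mem {G : Dgraph V} {C : Set V} {x y : V} (hx : x ∈ C) (hy : y ∈ C) :
    (G.reverseOn C).Arc x y ↔ G.Arc y x := by
  simp [reverseOn, hx, hy]

theorem reverseOn_arc_of_not {G : Dgraph V} {C : Set V} {x y : V} (h : ¬ (x ∈ C ∧ y ∈ C)) :
    (G.reverseOn C).Arc x y ↔ G.Arc x y := by
  simp only [reverseOn, h, not_false_eq_true, true_and]
  tauto

theorem IsInterval.arc_iff {G : Dgraph V} {I : Set V} (h : G.IsInterval I) {x y z : V}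
    (hx : x ∉ I) (hy : y ∈ I) (hz : z ∈ I) :
    (G.Arc x y ↔ G.Arc x z) ∧ (G.Arc y x ↔ G.Arc z x) := by
  rcases h x hx with h | h | h | h <;> simp [h y hy, h z hz]

/-- An isomorphism of contracted digraphs fixing the contracted interval extends to the digraph
in which this interval is reversed. -/
theorem ContractIsoFix.exists_perm {G : Dgraph V} {C : Set V} (h : ContractIsoFix G G.dual C)
    (hC : G.IsInterval C) :
    ∃ φ : V ≃ V, ∀ x y, (G.reverseOn C).Arc x y ↔ G.Arc (φ y) (φ x) := by
  classical
  obtain ⟨e, hnone, he⟩ := h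
  have hsome : ∀ x, some (e.removeNone x) = e (some x) := by
    intro x
    refine e.removeNone_some ?_
    cases hx : e (some x) with
    | none => exact absurd (e.injective (hx.trans hnone.symm)) (by simp)
    | some y => exact ⟨y, rfl⟩
  let e' : Equiv.Perm {x // x ∉ C} := e.removeNone
  let φ : Equiv.Perm V := Equiv.Perm.ofSubtype e'
  have hin : ∀ x ∈ C, φ x = x := fun x hx =>
    Equiv.Perm.ofSubtype_apply_of_not_mem e' (not_not.2 hx)
  have hout : ∀ x (hx : x ∉ C), φ x = e.removeNone ⟨x, hx⟩ := fun x hx =>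
    Equiv.Perm.ofSubtype_apply_of_mem e' hx
  refine ⟨φ, fun x y => ?_⟩
  by_cases hx : x ∈ C <;> by_cases hy : y ∈ C
  · rw [reverseOn_arc_of_mem hx hy, hin x hx, hin y hy]
  · rw [reverseOn_arc_of_not fun h => hy h.2, hin x hx, hout y hy]
    have hmem := (e.removeNone ⟨y, hy⟩).2
    have := he none (some ⟨y, hy⟩)
    rw [hnone, ← hsome] at this
    calc G.Arc x y ↔ ∃ z ∈ C, G.Arc z y :=
          ⟨fun h => ⟨x, hx, h⟩, fun ⟨z, hz, h⟩ => (hC.arc_iff hy hx hz).2.2 h⟩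
      _ ↔ ∃ z ∈ C, G.Arc (e.removeNone ⟨y, hy⟩) z := this
      _ ↔ _ := ⟨fun ⟨z, hz, h⟩ => (hC.arc_iff hmem hx hz).1.2 h, fun h => ⟨x, hx, h⟩⟩
  · rw [reverseOn_arc_of_not fun h => hx h.1, hin y hy, hout x hx]
    have hmem := (e.removeNone ⟨x, hx⟩).2
    have := he (some ⟨x, hx⟩) none
    rw [hnone, ← hsome] at this
    calc G.Arc x y ↔ ∃ z ∈ C, G.Arc x z :=
          ⟨fun h => ⟨y, hy, h⟩, fun ⟨z, hz, h⟩ => (hC.arc_iff hx hy hz).1.2 h⟩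
      _ ↔ ∃ z ∈ C, G.Arc z (e.removeNone ⟨x, hx⟩) := this
      _ ↔ _ := ⟨fun ⟨z, hz, h⟩ => (hC.arc_iff hmem hy hz).2.2 h, fun h => ⟨y, hy, h⟩⟩
  · rw [reverseOn_arc_of_not fun h => hx h.1, hout x hx, hout y hy]
    have := he (some ⟨x, hx⟩) (some ⟨y, hy⟩)
    rw [← hsome, ← hsome] at this
    exact this

theorem OneEndInfiniteConsecutivity.of_iso {G : Dgraph V} {H : Dgraph W}
    (h : G.OneEndInfiniteConsecutivity) (e : Iso H G) : H.OneEndInfiniteConsecutivity :=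
  h.imp fun _ h => h.imp e.trans e.trans

theorem OneEndInfiniteConsecutivity.dual {G : Dgraph V} (h : G.OneEndInfiniteConsecutivity) :
    G.dual.OneEndInfiniteConsecutivity :=
  h.imp fun _ h => h.symm.imp (fun h => h.dual) (fun h => h.dual)

/-- If reversing the interval `C` yields the dual, the only interval inducing a one-end infinite
consecutivity is self-dual when it is disjoint from `C`. -/
theorem selfDual_of_reverseOn {G : Dgraph V} {C D : Set V} (hCD : Disjoint C D) {φ : V ≃ V}
    (hφ : ∀ x y, (G.reverseOn C).Arc x y ↔ G.Arc (φ y) (φ x)) (hD : G.IsInterval D)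
    (hone : (G.ind D).OneEndInfiniteConsecutivity)
    (huniq : ∀ J, G.IsInterval J → (G.ind J).OneEndInfiniteConsecutivity → J = D) :
    SelfDual (G.ind D) := by
  have harc : ∀ x, ∀ y ∈ D, (G.Arc x y ↔ G.Arc (φ y) (φ x)) ∧ (G.Arc y x ↔ G.Arc (φ x) (φ y)) :=
    fun x y hy => by
      have hyC : y ∉ C := fun h => hCD.le_bot ⟨h, hy⟩
      rw [← hφ, ← hφ, reverseOn_arc_of_not fun h => hyC h.2, reverseOn_arc_of_not fun h => hyC h.1]
      exact ⟨Iff.rfl, Iff.rfl⟩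
  have hiso : Iso (G.ind D) (G.ind (φ '' D)).dual :=
    ⟨φ.image D, fun x y => (harc x y y.2).1⟩
  have himg : φ '' D = D := by
    refine huniq _ (fun z hz => ?_) (hone.dual.of_iso hiso.dual.symm)
    obtain ⟨x, rfl⟩ := φ.surjective z
    have hx : x ∉ D := fun h => hz ⟨x, h, rfl⟩
    simp only [Set.forall_mem_image]
    rcases hD x hx with h | h | h | h
    · exact Or.inr (Or.inl fun y hy => by rw [← (harc x y hy).1, ← (harc x y hy).2]; exact h y hy)
    · exact Or.inl fun y hy => by rw [← (harc x y hy).1, ← (harc x y hy).2]; exact h y hy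
    · exact Or.inr (Or.inr (Or.inl fun y hy => by
        rw [← (harc x y hy).1, ← (harc x y hy).2]; exact (h y hy).symm))
    · exact Or.inr (Or.inr (Or.inr fun y hy => by
        rw [← (harc x y hy).1, ← (harc x y hy).2]; exact (h y hy).symm))
  rw [himg] at hiso
  exact hiso

theorem HemiSix.iso_of_revClass {G H G' : Dgraph V} (h : HemiSix G G') (hG : G.ArcConnected)
    {c : V} (hc : revClass G G' c ≠ Set.univ)
    (hcross : ∀ x y, y ∉ revClass G G' x → pairCode H x y = pairCode G x y)
    (hiso : ∀ x, Iso (H.ind (revClass G G' x)) (G'.ind (revClass G G' x))) : Iso H G' := by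
  have hunif := fun x => (h.revClass_interval hG (revClass_ne_univ hc x)).2
  refine exists_equiv_of_fibers (Quotient.mk (revSetoid G G')) (fun x y z hyz hxy => ?_)
    (fun x y hxy => ?_) fun i => ?_
  · obtain ⟨j, hj⟩ := hunif y x fun hx => hxy (mk_eq_mk_iff.2 hx).symm
    rw [hcross x y fun hy => hxy (mk_eq_mk_iff.2 hy),
      hcross x z fun hz => hxy ((mk_eq_mk_iff.2 hz).trans hyz.symm),
      (hj y Relation.ReflTransGen.refl).1, (hj z (mk_eq_mk_iff.1 hyz)).1]
  · obtain ⟨j, hj⟩ := hunif y x fun hx => hxy (mk_eq_mk_iff.2 hx).symm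
    rw [hcross x y fun hy => hxy (mk_eq_mk_iff.2 hy),
      (hj y Relation.ReflTransGen.refl).1, (hj y Relation.ReflTransGen.refl).2]
  · induction i using Quotient.inductionOn with
    | h x =>
      rw [show {y | Quotient.mk (revSetoid G G') y = Quotient.mk _ x} = revClass G G' x from
        fiber_mk_eq x]
      exact hiso x

theorem HemiSix.hemi_of_revClass {G G' : Dgraph V} (h : HemiSix G G') (hG : G.ArcConnected)
    (hcinf : ¬ G.CondCinf) (hL1 : ¬ G.CondL1) (hL2 : ¬ G.CondL2) (hfin : NoInfChain G)
    {c : V} (hc : revClass G G' c ≠ Set.univ) : Hemi G G' := by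
  have hcl := revClass_ne_univ hc
  have hI := fun x => (h.revClass_classify hG hfin (hcl x)).1
  by_cases hbad : ∀ x, Iso (G.ind (revClass G G' x)) (G'.ind (revClass G G' x))
  · exact Or.inl (h.iso_of_revClass hG hc (fun _ _ _ => rfl) hbad)
  push Not at hbad
  obtain ⟨a, ha⟩ := hbad
  have hdual : ∀ x, ¬ Iso (G.ind (revClass G G' x)) (G'.ind (revClass G G' x)) →
      Iso (G.ind (revClass G G' x)).dual (G'.ind (revClass G G' x)) := fun x hx =>
    ((h.revClass_classify hG hfin (hcl x)).2.resolve_left hx).1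
  have hns : ∀ x, ¬ Iso (G.ind (revClass G G' x)) (G'.ind (revClass G G' x)) →
      ¬ SelfDual (G.ind (revClass G G' x)) := fun x hx hs => hx (hs.trans (hdual x hx))
  have hkind : ∀ x, ¬ Iso (G.ind (revClass G G' x)) (G'.ind (revClass G G' x)) →
      G.L12Int (revClass G G' x) ∨ (G.ind (revClass G G' x)).OneEndInfiniteConsecutivity := by
    intro x hx
    rcases ((h.revClass_classify hG hfin (hcl x)).2.resolve_left hx).2 with h1 | h1 | h1
    · refine Or.inl ⟨hI x, h1, hns x hx, ?_⟩
      rintro ⟨y, hy⟩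
      exact hcl x (hy.trans (Set.eq_univ_of_forall fun z => hG y z))
    · exact absurd h1 (hns x hx)
    · exact Or.inr h1
  have huL : ∀ {I J}, G.L12Int I → G.L12Int J → J = I := fun hI hJ => by
    by_contra hne
    exact hL1 ⟨_, _, hne, hJ, hI⟩
  have huE : ∀ {I}, G.IsInterval I → (G.ind I).OneEndInfiniteConsecutivity →
      ∀ J, G.IsInterval J → (G.ind J).OneEndInfiniteConsecutivity → J = I :=
    fun hI hI' J hJ hJ' => by
      by_contra hne
      exact hcinf (Or.inr (Or.inl ⟨_, _, hne, hJ, hI, hJ', hI'⟩))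
  have hfixL : ∀ {I}, G.L12Int I → ContractIsoFix G G.dual I := fun hI => by
    by_contra hno
    exact hL2 ⟨_, hI, fun J hJ => huL hI hJ, hno⟩
  have hfix : ContractIsoFix G G.dual (revClass G G' a) := by
    rcases hkind a ha with h1 | h1
    · exact hfixL h1
    · by_contra hno
      exact hcinf (Or.inr (Or.inr ⟨_, hI a, h1, huE (hI a) h1, hno⟩))
  have hdisj : ∀ {x y}, revClass G G' x ≠ revClass G G' y →
      Disjoint (revClass G G' x) (revClass G G' y) := by
    intro x y hne
    refine Set.disjoint_left.2 fun z hx hy => hne ?_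
    rw [← fiber_mk_eq, ← fiber_mk_eq, mk_eq_mk_iff.2 hx, mk_eq_mk_iff.2 hy]
  have hmixed : ∀ {x y}, G.L12Int (revClass G G' x) →
      (G.ind (revClass G G' y)).OneEndInfiniteConsecutivity →
      ¬ Iso (G.ind (revClass G G' y)) (G'.ind (revClass G G' y)) →
      revClass G G' x ≠ revClass G G' y → False := by
    intro x y hx hy hy' hne
    obtain ⟨φ, hφ⟩ := (hfixL hx).exists_perm (hI x)
    exact hns y hy' (selfDual_of_reverseOn (hdisj hne) hφ (hI y) hy (huE (hI y) hy))
  have huniq : ∀ x, ¬ Iso (G.ind (revClass G G' x)) (G'.ind (revClass G G' x)) →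
      revClass G G' x = revClass G G' a := by
    intro x hx
    by_contra hne
    rcases hkind x hx with h1 | h1 <;> rcases hkind a ha with h2 | h2
    · exact hne (huL h2 h1)
    · exact hmixed h1 h2 ha hne
    · exact hmixed h2 h1 hx (Ne.symm hne)
    · exact hne (huE (hI a) h2 _ (hI x) h1)
  obtain ⟨φ, hφ⟩ := hfix.exists_perm (hI a)
  have hrev : Iso (G.reverseOn (revClass G G' a)) G' := by
    refine h.iso_of_revClass hG hc (fun x y hxy => ?_) fun x => ?_
    · have hn : ∀ {x y}, y ∉ revClass G G' x → ¬ (x ∈ revClass G G' a ∧ y ∈ revClass G G' a) :=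
        fun hxy h => hxy (mk_eq_mk_iff.1 ((mk_eq_mk_iff.2 h.1).symm.trans (mk_eq_mk_iff.2 h.2)))
      exact pairCode_congr (reverseOn_arc_of_not (hn hxy))
        (reverseOn_arc_of_not fun h => hn hxy h.symm)
    · by_cases hx : Iso (G.ind (revClass G G' x)) (G'.ind (revClass G G' x))
      · have hne : revClass G G' x ≠ revClass G G' a := fun he => ha (he ▸ hx)
        refine Iso.trans ⟨Equiv.refl _, fun y z => ?_⟩ hx
        exact reverseOn_arc_of_not fun h => (hdisj hne).le_bot ⟨y.2, h.1⟩
      · rw [huniq x hx]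
        refine Iso.trans ⟨Equiv.refl _, fun y z => ?_⟩ (hdual a ha)
        exact reverseOn_arc_of_mem y.2 z.2
  have hG' : Iso (G.reverseOn (revClass G G' a)) G.dual := ⟨φ, hφ⟩
  exact Or.inr (hG'.symm.trans hrev)

end Dgraph

/-- Two (≤6)-hemimorphic arc-connected digraphs, the first of which satisfies none
of C∞, L1, L2, are hemimorphic. -/
theorem hemi_of_arcConnected_le_six_hemi {V : Type u} (G G' : Dgraph V)
    (hhemi : Dgraph.LeHemi 6 G G') (hG : G.ArcConnected) (hG' : G'.ArcConnected)
    (hcinf : ¬ G.CondCinf) (hL1 : ¬ G.CondL1) (hL2 : ¬ G.CondL2) :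
    Dgraph.Hemi G G' := by
  have h := hemiSix_of_leHemi hhemi
  have hfin : NoInfChain G := fun I hI hc => by
    by_contra hinf
    exact hcinf (Or.inl ⟨I, hinf, hI, hc⟩)
  by_cases hM : ∃ c, revClass G G' c ≠ Set.univ
  · obtain ⟨c, hc⟩ := hM
    exact h.hemi_of_revClass hG hcinf hL1 hL2 hfin hc
  by_cases hP : ∃ c, revClass G G'.dual c ≠ Set.univ
  · obtain ⟨c, hc⟩ := hP
    exact (h.dual_right.hemi_of_revClass hG hcinf hL1 hL2 hfin hc).dual_right
  push Not at hM hP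
  have hc : G.IsChainD := by
    refine h.isChainD hG (fun x y => ?_) fun x y => ?_
    · rw [← rev_dual_eq]
      exact (hP x).ge (Set.mem_univ y)
    · exact (hM x).ge (Set.mem_univ y)
  have hV := hfin Set.univ (fun x hx => absurd (Set.mem_univ x) hx)
    ⟨fun x y hne => hc.1 x y (Subtype.coe_injective.ne hne), fun x y z => hc.2 x y z⟩
  have := Set.finite_univ_iff.1 hV
  exact Or.inl (hc.iso (h.isChainD_right hc))
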